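/- If T ∈ ITM(r) is stable and satisfies conditions A1 and A2, then T satisfies the Matching condition. -/

import Mathlib

open Set Filter
open scoped Classical

/-- An interval translation map on `r ≥ 2` intervals: discontinuity points
`0 = β₀ < β₁ < ⋯ < β_{r−1} < β_r = 1` and translation parameters
`γ_i ∈ [−β_{i−1}, 1−β_i]`, acting by `T(x) = x + γ_i` for `x ∈ [β_{i−1}, β_i)`. -/
structure ITM (r : ℕ) : Type where
  beta : Fin (r + 1) → ℝ
  gamma : Fin r → ℝ
  two_le_r : 2 ≤ r
  beta_zero : beta 0 = 0
  beta_last : beta (Fin.last r) = 1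
  beta_mono : StrictMono beta
  gamma_mem : ∀ i : Fin r, gamma i ∈ Set.Icc (-(beta i.castSucc)) (1 - beta i.succ)

namespace ITM

variable {r : ℕ}

/-- The unit interval `I = [0,1)`. -/
def unitIco : Set ℝ := Set.Ico 0 1

/-- Index of the partition interval `I_i = [β_{i−1}, β_i)` containing `x`. -/
noncomputable def idx (T : ITM r) (x : ℝ) : Fin r :=
  if h : ∃ i : Fin r, x ∈ Set.Ico (T.beta i.castSucc) (T.beta i.succ) then h.choose
  else ⟨0, by have := T.two_le_r; omega⟩

/-- The interval translation map itself (right-continuous version), extended by the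
identity off `[0,1)`. -/
noncomputable def f (T : ITM r) (x : ℝ) : ℝ :=
  if x ∈ unitIco then x + T.gamma (T.idx x) else x

/-- Index of the partition interval `(β_{i−1}, β_i]` containing `x` (left-limit version). -/
noncomputable def idxm (T : ITM r) (x : ℝ) : Fin r :=
  if h : ∃ i : Fin r, x ∈ Set.Ioc (T.beta i.castSucc) (T.beta i.succ) then h.choose
  else ⟨0, by have := T.two_le_r; omega⟩

/-- The left-limit version of `T`: `T(x⁻) = lim_{t↑x} T(t)`. -/
noncomputable def fm (T : ITM r) (x : ℝ) : ℝ :=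
  if x ∈ Set.Ioc (0 : ℝ) 1 then x + T.gamma (T.idxm x) else x

/-- Dynamics on signed points: `(x, true)` represents `x⁺` and `(x, false)` represents `x⁻`. -/
noncomputable def sf (T : ITM r) (p : ℝ × Bool) : ℝ × Bool :=
  if p.2 then (T.f p.1, true) else (T.fm p.1, false)

/-- `X_n = T^n(I)`. -/
noncomputable def Xn (T : ITM r) (n : ℕ) : Set ℝ := (T.f)^[n] '' unitIco

/-- The attractor `X = ⋂_{n≥0} X_n`. -/
noncomputable def X (T : ITM r) : Set ℝ := ⋂ n : ℕ, T.Xn n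

/-- The closure `X̄` of the attractor in `[0,1]` (equivalently, in `ℝ`). -/
noncomputable def Xbar (T : ITM r) : Set ℝ := closure T.X

/-- `T` is of finite type if `X_{n+1} = X_n` for some `n`. -/
def FiniteType (T : ITM r) : Prop := ∃ n : ℕ, T.Xn (n + 1) = T.Xn n

/-- The set of (unsigned) discontinuities `{β₁, …, β_{r−1}}` of `T`. -/
def critSet (T : ITM r) : Set ℝ :=
  {b : ℝ | ∃ i : Fin (r + 1), i ≠ 0 ∧ i ≠ Fin.last r ∧ b = T.beta i}

/-- The signed critical set `𝒞 = {β₁⁻, β₁⁺, …, β_{r−1}⁻, β_{r−1}⁺}`. -/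
def signedCrit (T : ITM r) : Set (ℝ × Bool) := {p : ℝ × Bool | p.1 ∈ T.critSet}

/-- `x` lands on a discontinuity of `T`: some forward iterate (`k ≥ 0`) is a discontinuity. -/
def landsOnCrit (T : ITM r) (x : ℝ) : Prop := ∃ k : ℕ, (T.f)^[k] x ∈ T.critSet

/-- The first return time of `x` to the set `J` (by convention `0` if `x` never returns). -/
noncomputable def returnTime (T : ITM r) (J : Set ℝ) (x : ℝ) : ℕ :=
  sInf {k : ℕ | 0 < k ∧ (T.f)^[k] x ∈ J}

/-- The first return map `R_J`. -/
noncomputable def returnMap (T : ITM r) (J : Set ℝ) (x : ℝ) : ℝ :=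
  (T.f)^[T.returnTime J x] x

/-- `J` is an interval component of `X`: a connected component of `X` which is a
(nondegenerate, half-open) interval `[x,y)`. -/
def IsIntervalComponent (T : ITM r) (J : Set ℝ) : Prop :=
  (∃ z ∈ T.X, J = connectedComponentIn T.X z) ∧ ∃ x y : ℝ, x < y ∧ J = Set.Ico x y

/-- A dynamically trivial interval component: no point of its interior lands on a
discontinuity and the first return map is the identity. -/
def DynTrivial (T : ITM r) (J : Set ℝ) : Prop :=
  T.IsIntervalComponent J ∧ (∀ a ∈ interior J, ¬ T.landsOnCrit a) ∧
    ∀ z ∈ J, T.returnMap J z = z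

/-- Signed membership in `[x,y)`: `+`-points of `[x,y)` and `−`-points of `(x,y]`. -/
def smem (x y : ℝ) (p : ℝ × Bool) : Prop :=
  if p.2 then p.1 ∈ Set.Ico x y else p.1 ∈ Set.Ioc x y

/-- First return time of a signed point to the interval `[x,y)`. -/
noncomputable def sReturnTime (T : ITM r) (x y : ℝ) (p : ℝ × Bool) : ℕ :=
  sInf {k : ℕ | 0 < k ∧ smem x y ((T.sf)^[k] p)}

/-- Condition A1: for every interval component `J` of `X` and every `a ∈ J`, the orbit of
`a` up to (and not including) its return time to `J` contains at most one critical point. -/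
def A1 (T : ITM r) : Prop :=
  ∀ J : Set ℝ, T.IsIntervalComponent J → ∀ a ∈ J,
    Set.Subsingleton {c : ℝ | c ∈ T.critSet ∧ ∃ k < T.returnTime J a, (T.f)^[k] a = c}

/-- Condition A2: for every dynamically non-trivial interval component `[x,y)`, neither
(signed) boundary point `x⁺`, `y⁻` lands on a discontinuity up to (and not including)
its return time. -/
def A2 (T : ITM r) : Prop :=
  ∀ x y : ℝ, T.IsIntervalComponent (Set.Ico x y) → ¬ T.DynTrivial (Set.Ico x y) →
    (∀ k < T.sReturnTime x y (x, true), (T.sf)^[k] (x, true) ∉ T.signedCrit) ∧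
    (∀ k < T.sReturnTime x y (y, false), (T.sf)^[k] (y, false) ∉ T.signedCrit)

/-- `c'` is a ghost preimage of `c`: a signed discontinuity of opposite sign whose
(signed) orbit lands on the point of `c` with the sign of `c'`. -/
def GhostPre (T : ITM r) (c' c : ℝ × Bool) : Prop :=
  c ∈ T.signedCrit ∧ c' ∈ T.signedCrit ∧ c'.2 = !c.2 ∧
    ∃ k : ℕ, (T.sf)^[k] c' = (c.1, c'.2)

/-- A descending chain of length `n` in a ghost tree: `c (i+1)` is a ghost preimage of `c i`. -/
def GhostChain (T : ITM r) (n : ℕ) (c : ℕ → ℝ × Bool) : Prop :=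
  ∀ i < n, T.GhostPre (c (i + 1)) (c i)

/-- `b` occurs as a vertex of positive level in its own ghost tree `GT(b)`. -/
def SelfGhost (T : ITM r) (b : ℝ × Bool) : Prop :=
  ∃ n : ℕ, 0 < n ∧ ∃ c : ℕ → ℝ × Bool, c 0 = b ∧ c n = b ∧ T.GhostChain n c

/-- Condition A3: no discontinuity `β ∉ X` occurs in its own ghost tree at positive level. -/
def A3 (T : ITM r) : Prop := ∀ b ∈ T.signedCrit, b.1 ∉ T.X → ¬ T.SelfGhost b

/-- The Absence of Critical Connections condition. -/
def ACC (T : ITM r) : Prop := T.A1 ∧ T.A2 ∧ T.A3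

/-- The Matching condition: for every dynamically non-trivial interval component `J` of
`X`, exactly one point of the interior of `J` lands on a critical point before returning. -/
def Matching (T : ITM r) : Prop :=
  ∀ J : Set ℝ, T.IsIntervalComponent J → ¬ T.DynTrivial J →
    ∃! a : ℝ, a ∈ interior J ∧ ∃ k < T.returnTime J a, (T.f)^[k] a ∈ T.critSet

/-- Distance between two maps in the parameter space `ITM(r)`. -/
noncomputable def pdist (T S : ITM r) : ℝ := dist T.gamma S.gamma ⊔ dist T.beta S.beta

/-- The number of discontinuities of `T` contained in `I ∖ X̄`. -/
noncomputable def ncritOutside (T : ITM r) : ℕ := (T.critSet \ T.Xbar).ncard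

/-- `T` is stable: on some neighbourhood `𝒰` of `T` in `ITM(r)`, the assignment
`T̃ ↦ X̄(T̃)` is continuous in the Hausdorff topology, all `X̄(T̃)` are homeomorphic to
`X̄(T)`, and the number of discontinuities in `I ∖ X̄(T̃)` is constant. -/
def Stable (T : ITM r) : Prop :=
  ∃ δ : ℝ, 0 < δ ∧
    (∀ S : ITM r, pdist S T < δ → Nonempty (S.Xbar ≃ₜ T.Xbar)) ∧
    (∀ S : ITM r, pdist S T < δ → ∀ ε : ℝ, 0 < ε → ∃ η : ℝ, 0 < η ∧
      ∀ S' : ITM r, pdist S' T < δ → pdist S' S < η →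
        Metric.hausdorffDist S'.Xbar S.Xbar < ε) ∧
    (∀ S : ITM r, pdist S T < δ → S.ncritOutside = T.ncritOutside)

/-- The non-wandering set `Ω(T)` (neighbourhoods taken inside `I = [0,1)`). -/
def nonwandering (T : ITM r) : Set ℝ :=
  {x : ℝ | x ∈ unitIco ∧ ∀ U : Set ℝ, IsOpen U → x ∈ U →
    ∃ n : ℕ, 0 < n ∧ ((T.f)^[n] '' (U ∩ unitIco) ∩ (U ∩ unitIco)).Nonempty}

/-- `S` and `S'` are topologically conjugate on the sets `A`, `B`: there is a
homeomorphism `h : A → B` with `h ∘ S = S' ∘ h` on `A`. -/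
def TopConjOn (S S' : ITM r) (A B : Set ℝ) : Prop :=
  ∃ h g : ℝ → ℝ, Set.BijOn h A B ∧ ContinuousOn h A ∧ Set.InvOn g h A B ∧
    ContinuousOn g B ∧ ∀ x ∈ A, h (S.f x) = S'.f (h x)

/-- No point of the interior of `K` lands on a discontinuity before its return time to `J`. -/
def NoCritBeforeReturnOn (T : ITM r) (J K : Set ℝ) : Prop :=
  ∀ z ∈ interior K, ∀ k < T.returnTime J z, (T.f)^[k] z ∉ T.critSet

/-- `K` is a continuity interval of the first return map `R_J`: a maximal half-open
subinterval of `J` no interior point of which lands on a discontinuity before returning. -/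
def IsContinuityInterval (T : ITM r) (J K : Set ℝ) : Prop :=
  (∃ u v : ℝ, u < v ∧ K = Set.Ico u v) ∧ K ⊆ J ∧ T.NoCritBeforeReturnOn J K ∧
    ∀ K' : Set ℝ, (∃ u v : ℝ, u < v ∧ K' = Set.Ico u v) → K ⊆ K' → K' ⊆ J →
      T.NoCritBeforeReturnOn J K' → K' = K

/-- The itinerary symbol of a signed point. -/
noncomputable def sidx (T : ITM r) (p : ℝ × Bool) : Fin r :=
  if p.2 then T.idx p.1 else T.idxm p.1

/-- The forward orbit of `x` accumulates on `c` from the left. -/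
def accumFromLeft (T : ITM r) (x c : ℝ) : Prop :=
  ∃ n : ℕ → ℕ, StrictMono n ∧ StrictMono (fun k => (T.f)^[n k] x) ∧
    Filter.Tendsto (fun k => (T.f)^[n k] x) Filter.atTop (nhds c)

/-- The forward orbit of `x` accumulates on `c` from the right. -/
def accumFromRight (T : ITM r) (x c : ℝ) : Prop :=
  ∃ n : ℕ → ℕ, StrictMono n ∧ StrictAnti (fun k => (T.f)^[n k] x) ∧
    Filter.Tendsto (fun k => (T.f)^[n k] x) Filter.atTop (nhds c)

end ITM

namespace ITM

variable {r : ℕ}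

/-- The `i`-th continuity interval `[β_i, β_{i+1})`. -/
def cell (T : ITM r) (i : Fin r) : Set ℝ := Ico (T.beta i.castSucc) (T.beta i.succ)

theorem beta_nonneg (T : ITM r) (i : Fin (r + 1)) : 0 ≤ T.beta i :=
  T.beta_zero ▸ T.beta_mono.monotone (Fin.zero_le i)

theorem beta_le_one (T : ITM r) (i : Fin (r + 1)) : T.beta i ≤ 1 :=
  T.beta_last ▸ T.beta_mono.monotone (Fin.le_last i)

theorem cell_subset (T : ITM r) (i : Fin r) : T.cell i ⊆ unitIco := fun _ hx =>
  ⟨(T.beta_nonneg _).trans hx.1, hx.2.trans_le (T.beta_le_one _)⟩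

theorem exists_mem_cell (T : ITM r) {x : ℝ} (hx : x ∈ unitIco) : ∃ i, x ∈ T.cell i := by
  by_contra! h
  have key : ∀ k : Fin (r + 1), T.beta k ≤ x := by
    intro k
    induction k using Fin.induction with
    | zero => rw [T.beta_zero]; exact hx.1
    | succ i ih => exact not_lt.mp fun hlt => h i ⟨ih, hlt⟩
  have := key (Fin.last r)
  rw [T.beta_last] at this
  exact absurd hx.2 (not_lt.mpr this)

theorem cell_disjoint (T : ITM r) {i j : Fin r} {x : ℝ} (hi : x ∈ T.cell i) (hj : x ∈ T.cell j) :
    i = j := by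
  have aux : ∀ {i j : Fin r}, x ∈ T.cell i → x ∈ T.cell j → ¬ i < j := by
    intro i j hi hj hlt
    have : T.beta i.succ ≤ T.beta j.castSucc := T.beta_mono.monotone (by
      simp only [Fin.le_def, Fin.val_succ, Fin.val_castSucc]; exact hlt)
    exact absurd (hi.2.trans_le (this.trans hj.1)) (lt_irrefl _)
  exact le_antisymm (not_lt.mp (aux hj hi)) (not_lt.mp (aux hi hj))

theorem idx_eq (T : ITM r) {x : ℝ} {i : Fin r} (h : x ∈ T.cell i) : T.idx x = i := by
  have hex : ∃ i : Fin r, x ∈ Ico (T.beta i.castSucc) (T.beta i.succ) := ⟨i, h⟩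
  rw [idx, dif_pos hex]
  exact T.cell_disjoint hex.choose_spec h

theorem f_of_mem_cell (T : ITM r) {x : ℝ} {i : Fin r} (h : x ∈ T.cell i) :
    T.f x = x + T.gamma i := by
  rw [f, if_pos (T.cell_subset i h), T.idx_eq h]

theorem f_mem (T : ITM r) {x : ℝ} (hx : x ∈ unitIco) : T.f x ∈ unitIco := by
  obtain ⟨i, hi⟩ := T.exists_mem_cell hx
  rw [T.f_of_mem_cell hi]
  have := T.gamma_mem i
  exact ⟨by linarith [hi.1, this.1], by linarith [hi.2, this.2]⟩

theorem iterate_mem (T : ITM r) {x : ℝ} (hx : x ∈ unitIco) (n : ℕ) : T.f^[n] x ∈ unitIco := by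
  induction n with
  | zero => exact hx
  | succ n ih => rw [Function.iterate_succ_apply']; exact T.f_mem ih

theorem Xn_succ (T : ITM r) (n : ℕ) : T.Xn (n + 1) = T.f '' T.Xn n := by
  rw [Xn, Xn, ← image_comp, ← Function.iterate_succ']

theorem Xn_succ_subset (T : ITM r) (n : ℕ) : T.Xn (n + 1) ⊆ T.Xn n := by
  rintro _ ⟨x, hx, rfl⟩
  exact ⟨T.f x, T.f_mem hx, by rw [Function.iterate_succ_apply]⟩

theorem Xn_antitone (T : ITM r) : Antitone T.Xn := antitone_nat_of_succ_le T.Xn_succ_subset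

theorem Xn_subset (T : ITM r) (n : ℕ) : T.Xn n ⊆ unitIco := by
  rintro _ ⟨x, hx, rfl⟩
  exact T.iterate_mem hx n

theorem X_subset_Xn (T : ITM r) (n : ℕ) : T.X ⊆ T.Xn n := iInter_subset _ n

theorem X_subset (T : ITM r) : T.X ⊆ unitIco := (T.X_subset_Xn 0).trans (T.Xn_subset 0)

theorem f_mem_X (T : ITM r) {x : ℝ} (hx : x ∈ T.X) : T.f x ∈ T.X := by
  refine mem_iInter.mpr fun n => T.Xn_succ_subset n ?_
  rw [T.Xn_succ]
  exact ⟨x, mem_iInter.mp hx n, rfl⟩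

theorem iterate_mem_X (T : ITM r) {x : ℝ} (hx : x ∈ T.X) (n : ℕ) : T.f^[n] x ∈ T.X := by
  induction n with
  | zero => exact hx
  | succ n ih => rw [Function.iterate_succ_apply']; exact T.f_mem_X ih

/-- The map sends the attractor onto itself. -/
theorem exists_preimage_X (T : ITM r) {q : ℝ} (hq : q ∈ T.X) : ∃ p ∈ T.X, T.f p = q := by
  have h : ∀ n : ℕ, ∃ i : Fin r, q - T.gamma i ∈ T.cell i ∧ q - T.gamma i ∈ T.Xn n := by
    intro n
    have := mem_iInter.mp hq (n + 1)
    rw [T.Xn_succ] at this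
    obtain ⟨p, hp, hpq⟩ := this
    obtain ⟨i, hi⟩ := T.exists_mem_cell (T.Xn_subset n hp)
    rw [T.f_of_mem_cell hi] at hpq
    have : q - T.gamma i = p := by linarith
    exact ⟨i, this ▸ hi, this ▸ hp⟩
  choose g hg using h
  obtain ⟨i, hi⟩ := Finite.exists_infinite_fiber g
  have hinf : (g ⁻¹' {i}).Infinite := Set.infinite_coe_iff.mp hi
  have hmem : ∀ n, q - T.gamma i ∈ T.Xn n := by
    intro n
    obtain ⟨m, hm, hnm⟩ := hinf.exists_gt n
    have := (hg m).2
    rw [show g m = i from hm] at this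
    exact T.Xn_antitone hnm.le this
  obtain ⟨m, hm⟩ := hinf.nonempty
  have hc := (hg m).1
  rw [show g m = i from hm] at hc
  exact ⟨_, mem_iInter.mpr hmem, by rw [T.f_of_mem_cell hc]; ring⟩

theorem critSet_finite (T : ITM r) : T.critSet.Finite :=
  (finite_range T.beta).subset fun _ ⟨i, _, _, h⟩ => ⟨i, h.symm⟩

/-- An interval whose interior avoids the discontinuities for `n` steps is translated by the
first `n` iterates. -/
theorem iterate_add (T : ITM r) {a e : ℝ} (hI : Ico a (a + e) ⊆ unitIco) (n : ℕ)
    (h : ∀ z ∈ Ioo a (a + e), ∀ k < n, T.f^[k] z ∉ T.critSet) :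
    ∀ t ∈ Ico 0 e, T.f^[n] (a + t) = T.f^[n] a + t := by
  induction n with
  | zero => intro t _; rfl
  | succ n ih =>
    have ih' := ih fun z hz k hk => h z hz k (by omega)
    intro t ht
    have ha : a ∈ unitIco := hI ⟨le_rfl, by linarith [ht.1, ht.2]⟩
    have hat : a + t ∈ unitIco := hI ⟨by linarith [ht.1], by linarith [ht.2]⟩
    obtain ⟨i, hi⟩ := T.exists_mem_cell (T.iterate_mem ha n)
    have hmem := T.iterate_mem hat n
    rw [ih' t ht] at hmem
    have hti : T.f^[n] a + t ∈ T.cell i := by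
      refine ⟨by linarith [hi.1, ht.1], ?_⟩
      by_contra! hge
      set s := T.beta i.succ - T.f^[n] a with hs
      have hs0 : 0 < s := by linarith [hi.2]
      have hst : s ≤ t := by linarith
      refine h (a + s) ⟨by linarith, by linarith [ht.2]⟩ n (Nat.lt_succ_self n) ?_
      rw [ih' s ⟨hs0.le, hst.trans_lt ht.2⟩]
      refine ⟨i.succ, Fin.succ_ne_zero i, ?_, by rw [hs]; ring⟩
      intro hlast
      rw [hlast, T.beta_last] at hge
      exact absurd hmem.2 (not_lt.mpr hge)
    rw [Function.iterate_succ_apply', Function.iterate_succ_apply', ih' t ht,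
      T.f_of_mem_cell hti, T.f_of_mem_cell hi]
    ring

/-- Iterates are locally translations to the right of any point. -/
theorem exists_iterate_add (T : ITM r) {p : ℝ} (hp : p ∈ unitIco) (n : ℕ) :
    ∃ e > 0, Ico p (p + e) ⊆ unitIco ∧ ∀ t ∈ Ico 0 e, T.f^[n] (p + t) = T.f^[n] p + t := by
  induction n with
  | zero => exact ⟨1 - p, by linarith [hp.2], fun x hx => ⟨hp.1.trans hx.1, by linarith [hx.2]⟩,
      fun t _ => rfl⟩
  | succ n ih =>
    obtain ⟨e, he, hI, h⟩ := ih
    obtain ⟨i, hi⟩ := T.exists_mem_cell (T.iterate_mem hp n)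
    refine ⟨min e (T.beta i.succ - T.f^[n] p), lt_min he (by linarith [hi.2]), fun x hx =>
      hI ⟨hx.1, hx.2.trans_le (by linarith [min_le_left e (T.beta i.succ - T.f^[n] p)])⟩, ?_⟩
    intro t ht
    have h1 : t < e := ht.2.trans_le (min_le_left _ _)
    have h2 : t < T.beta i.succ - T.f^[n] p := ht.2.trans_le (min_le_right _ _)
    have hti : T.f^[n] p + t ∈ T.cell i := ⟨by linarith [hi.1, ht.1], by linarith⟩
    rw [Function.iterate_succ_apply', Function.iterate_succ_apply', h t ⟨ht.1, h1⟩,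
      T.f_of_mem_cell hti, T.f_of_mem_cell hi]
    ring

/-- Real step functions: linear combinations of indicators of half-open intervals. -/
def stepSpan : Submodule ℝ (ℝ → ℝ) :=
  Submodule.span ℝ (range fun p : ℝ × ℝ => (Ico p.1 p.2).indicator (1 : ℝ → ℝ))

/-- A finite union of half-open intervals, described by its indicator function. -/
def IsStep (A : Set ℝ) : Prop := A.indicator (1 : ℝ → ℝ) ∈ stepSpan

theorem isStep_Ico (a b : ℝ) : IsStep (Ico a b) := Submodule.subset_span ⟨(a, b), rfl⟩

theorem isStep_empty : IsStep ∅ := by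
  rw [IsStep, indicator_empty]; exact stepSpan.zero_mem

theorem stepSpan_mul {F G : ℝ → ℝ} (hF : F ∈ stepSpan) (hG : G ∈ stepSpan) :
    F * G ∈ stepSpan := by
  induction hF, hG using Submodule.span_induction₂ with
  | mem_mem x y hx hy =>
    obtain ⟨p, rfl⟩ := hx
    obtain ⟨q, rfl⟩ := hy
    have : (Ico p.1 p.2).indicator (1 : ℝ → ℝ) * (Ico q.1 q.2).indicator (1 : ℝ → ℝ) =
        (Ico (p.1 ⊔ q.1) (p.2 ⊓ q.2)).indicator 1 := by
      rw [← Ico_inter_Ico, inter_indicator_one]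
    rw [this]
    exact isStep_Ico _ _
  | zero_left y hy => rw [zero_mul]; exact stepSpan.zero_mem
  | zero_right x hx => rw [mul_zero]; exact stepSpan.zero_mem
  | add_left x y z hx hy hz h1 h2 => rw [add_mul]; exact stepSpan.add_mem h1 h2
  | add_right x y z hx hy hz h1 h2 => rw [mul_add]; exact stepSpan.add_mem h1 h2
  | smul_left c x y hx hy h => rw [smul_mul_assoc]; exact stepSpan.smul_mem c h
  | smul_right c x y hx hy h => rw [mul_smul_comm]; exact stepSpan.smul_mem c h

theorem IsStep.inter {A B : Set ℝ} (hA : IsStep A) (hB : IsStep B) : IsStep (A ∩ B) := by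
  rw [IsStep, inter_indicator_one]; exact stepSpan_mul hA hB

theorem IsStep.union {A B : Set ℝ} (hA : IsStep A) (hB : IsStep B) : IsStep (A ∪ B) := by
  have : (A ∪ B).indicator (1 : ℝ → ℝ) =
      A.indicator 1 + B.indicator 1 - (A ∩ B).indicator 1 := by
    rw [← indicator_union_add_inter]; simp
  rw [IsStep, this]
  exact stepSpan.sub_mem (stepSpan.add_mem hA hB) (hA.inter hB)

theorem isStep_biUnion {ι : Type*} (s : Finset ι) {A : ι → Set ℝ} (h : ∀ i ∈ s, IsStep (A i)) :
    IsStep (⋃ i ∈ s, A i) := by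
  induction s using Finset.induction_on with
  | empty => simpa using isStep_empty
  | insert a s ha ih =>
    rw [Finset.set_biUnion_insert]
    exact (h a (by simp)).union (ih fun i hi => h i (by simp [hi]))

theorem stepSpan_translate {F : ℝ → ℝ} (hF : F ∈ stepSpan) (c : ℝ) :
    (fun x => F (x - c)) ∈ stepSpan := by
  induction hF using Submodule.span_induction with
  | mem x hx =>
    obtain ⟨p, rfl⟩ := hx
    have : (fun x => (Ico p.1 p.2).indicator (1 : ℝ → ℝ) (x - c)) =
        (Ico (p.1 + c) (p.2 + c)).indicator 1 := by
      ext x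
      simp only [indicator_apply, mem_Ico, le_sub_iff_add_le, sub_lt_iff_lt_add, Pi.one_apply]
    simp only [this]
    exact isStep_Ico _ _
  | zero => exact stepSpan.zero_mem
  | add x y hx hy h1 h2 => exact stepSpan.add_mem h1 h2
  | smul a x hx h => exact stepSpan.smul_mem a h

theorem IsStep.translate {A : Set ℝ} (hA : IsStep A) (c : ℝ) :
    IsStep ((fun x => x + c) '' A) := by
  have : ((fun x => x + c) '' A).indicator (1 : ℝ → ℝ) =
      fun x => A.indicator (1 : ℝ → ℝ) (x - c) := by
    ext x
    simp only [image_add_right, indicator_apply, mem_preimage, sub_eq_add_neg, Pi.one_apply]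
  rw [IsStep, this]
  exact stepSpan_translate hA c

theorem stepSpan_right {F : ℝ → ℝ} (hF : F ∈ stepSpan) (p : ℝ) :
    ∃ e > 0, ∀ t ∈ Ico p (p + e), F t = F p := by
  induction hF using Submodule.span_induction with
  | mem x hx =>
    obtain ⟨⟨a, b⟩, rfl⟩ := hx
    rcases lt_or_ge p a with h | h
    · refine ⟨a - p, by linarith, fun t ht => ?_⟩
      dsimp only
      rw [indicator_of_notMem, indicator_of_notMem]
      · exact fun h' => by linarith [h'.1]
      · exact fun h' => by linarith [h'.1, ht.2]
    rcases lt_or_ge p b with h' | h'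
    · refine ⟨b - p, by linarith, fun t ht => ?_⟩
      dsimp only
      rw [indicator_of_mem, indicator_of_mem]
      · rfl
      · exact ⟨h, h'⟩
      · exact ⟨h.trans ht.1, by linarith [ht.2]⟩
    · refine ⟨1, by linarith, fun t ht => ?_⟩
      dsimp only
      rw [indicator_of_notMem, indicator_of_notMem]
      · exact fun h => by linarith [h.2]
      · exact fun h => by linarith [h.2, ht.1]
  | zero => exact ⟨1, one_pos, fun _ _ => rfl⟩
  | add x y hx hy h1 h2 =>
    obtain ⟨e, he, h1⟩ := h1
    obtain ⟨e', he', h2⟩ := h2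
    refine ⟨min e e', lt_min he he', fun t ht => ?_⟩
    rw [Pi.add_apply, Pi.add_apply, h1 t ⟨ht.1, by linarith [ht.2, min_le_left e e']⟩,
      h2 t ⟨ht.1, by linarith [ht.2, min_le_right e e']⟩]
  | smul a x hx h =>
    obtain ⟨e, he, h⟩ := h
    exact ⟨e, he, fun t ht => by rw [Pi.smul_apply, Pi.smul_apply, h t ht]⟩

theorem IsStep.right {A : Set ℝ} (hA : IsStep A) (p : ℝ) :
    ∃ e > 0, ∀ t ∈ Ico p (p + e), (t ∈ A ↔ p ∈ A) := by
  obtain ⟨e, he, h⟩ := stepSpan_right hA p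
  refine ⟨e, he, fun t ht => ?_⟩
  have := h t ht
  by_cases h1 : t ∈ A <;> by_cases h2 : p ∈ A <;> simp_all

theorem IsStep.measurableSet {A : Set ℝ} (hA : IsStep A) : MeasurableSet A := by
  have key : ∀ F ∈ stepSpan, Measurable F := by
    intro F hF
    induction hF using Submodule.span_induction with
    | mem x hx =>
      obtain ⟨p, rfl⟩ := hx
      exact measurable_one.indicator measurableSet_Ico
    | zero => exact measurable_zero
    | add x y hx hy h1 h2 => exact h1.add h2
    | smul a x hx h => exact h.const_smul a
  have := key _ hA (measurableSet_singleton 1)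
  convert this using 1
  ext x
  by_cases h : x ∈ A <;> simp [h]

theorem image_f_eq (T : ITM r) {A : Set ℝ} (hA : A ⊆ unitIco) :
    T.f '' A = ⋃ i ∈ (Finset.univ : Finset (Fin r)), (fun x => x + T.gamma i) '' (A ∩ T.cell i) := by
  ext q
  simp only [mem_image, Finset.mem_univ, iUnion_true, mem_iUnion]
  constructor
  · rintro ⟨x, hx, rfl⟩
    obtain ⟨i, hi⟩ := T.exists_mem_cell (hA hx)
    exact ⟨i, x, ⟨hx, hi⟩, (T.f_of_mem_cell hi).symm⟩
  · rintro ⟨i, x, hx, rfl⟩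
    exact ⟨x, hx.1, T.f_of_mem_cell hx.2⟩

theorem isStep_cell (T : ITM r) (i : Fin r) : IsStep (T.cell i) := isStep_Ico _ _

theorem isStep_Xn (T : ITM r) (n : ℕ) : IsStep (T.Xn n) := by
  induction n with
  | zero => simpa [Xn, unitIco] using isStep_Ico 0 1
  | succ n ih =>
    rw [T.Xn_succ, T.image_f_eq (T.Xn_subset n)]
    exact isStep_biUnion _ fun i _ => (ih.inter (T.isStep_cell i)).translate _

theorem Xbar_subset_Icc (T : ITM r) : T.Xbar ⊆ Icc 0 1 :=
  closure_minimal (T.X_subset.trans Ico_subset_Icc_self) isClosed_Icc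

theorem isCompact_Xbar (T : ITM r) : IsCompact T.Xbar :=
  isCompact_Icc.of_isClosed_subset isClosed_closure T.Xbar_subset_Icc

/-- Half-open intervals contained in the closed attractor are contained in the attractor. -/
theorem Ico_subset_X (T : ITM r) {a b : ℝ} (h : Ico a b ⊆ T.Xbar) : Ico a b ⊆ T.X := by
  intro p hp
  refine mem_iInter.mpr fun n => ?_
  obtain ⟨e, he, hloc⟩ := (T.isStep_Xn n).right p
  set m := min (p + e) b
  have hm : p < m := lt_min (by linarith) hp.2
  have hmid : (p + m) / 2 ∈ T.Xbar :=
    h ⟨by linarith [hp.1], by linarith [min_le_right (p + e) b]⟩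
  obtain ⟨x, hx, hxX⟩ := mem_closure_iff.mp hmid (Ioo p m) isOpen_Ioo
    ⟨by linarith, by linarith⟩
  exact (hloc x ⟨hx.1.le, hx.2.trans_le (min_le_left _ _)⟩).mp (T.X_subset_Xn n hxX)

theorem finite_components {K : Set ℝ} (hfin : Finite (ConnectedComponents K)) :
    {C | ∃ p ∈ K, C = connectedComponentIn K p}.Finite := by
  refine (finite_range fun c : ConnectedComponents K =>
    Subtype.val '' (ConnectedComponents.mk ⁻¹' {c})).subset ?_
  rintro _ ⟨p, hp, rfl⟩
  refine ⟨((⟨p, hp⟩ : K) : ConnectedComponents K), ?_⟩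
  dsimp only
  rw [connectedComponents_preimage_singleton, connectedComponentIn_eq_image hp]

theorem component_eq_Icc {K : Set ℝ} (hK : IsCompact K) {p : ℝ} (hp : p ∈ K) :
    connectedComponentIn K p =
      Icc (sInf (connectedComponentIn K p)) (sSup (connectedComponentIn K p)) := by
  refine eq_Icc_of_connected_compact (isConnected_connectedComponentIn_iff.mpr hp) ?_
  have : CompactSpace K := isCompact_iff_compactSpace.mp hK
  rw [connectedComponentIn_eq_image hp]
  exact isClosed_connectedComponent.isCompact.image continuous_subtype_val

/-- Points fixed by an iterate belong to the attractor. -/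
theorem mem_X_of_periodic (T : ITM r) {p : ℝ} (hp : p ∈ unitIco) {m : ℕ} (hm : 0 < m)
    (h : T.f^[m] p = p) : p ∈ T.X := by
  refine mem_iInter.mpr fun n => T.Xn_antitone (Nat.le_mul_of_pos_left n hm) ⟨p, hp, ?_⟩
  rw [Function.iterate_mul]
  exact Function.iterate_fixed h n

/-- If the closed attractor has finitely many components, every point of the attractor is the
left end point of an interval inside the attractor. -/
theorem exists_Ico_subset_X (T : ITM r) (hfin : Finite (ConnectedComponents T.Xbar)) {p : ℝ}
    (hp : p ∈ T.X) : ∃ e > 0, Ico p (p + e) ⊆ T.X := by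
  set F : Set ℝ := {p ∈ T.X | ¬ ∃ e > 0, Ico p (p + e) ⊆ T.X} with hF
  have hFfin : F.Finite := by
    refine ((finite_components hfin).image sSup).subset ?_
    rintro q ⟨hqX, hq⟩
    have hqK : q ∈ T.Xbar := subset_closure hqX
    refine ⟨_, ⟨q, hqK, rfl⟩, ?_⟩
    have hIcc := component_eq_Icc T.isCompact_Xbar hqK
    set C := connectedComponentIn T.Xbar q
    have hqC : q ∈ Icc (sInf C) (sSup C) := hIcc ▸ mem_connectedComponentIn hqK
    by_contra hne
    have hlt : q < sSup C := lt_of_le_of_ne hqC.2 (Ne.symm hne)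
    refine hq ⟨sSup C - q, by linarith, T.Ico_subset_X fun x hx => ?_⟩
    refine connectedComponentIn_subset T.Xbar q ?_
    change x ∈ C
    rw [hIcc]
    exact ⟨hqC.1.trans hx.1, by linarith [hx.2]⟩
  have hpre : ∀ q : F, ∃ p : F, T.f p = q := by
    rintro ⟨q, hqX, hq⟩
    obtain ⟨p, hpX, hpq⟩ := T.exists_preimage_X hqX
    refine ⟨⟨p, hpX, ?_⟩, hpq⟩
    rintro ⟨e, he, hsub⟩
    obtain ⟨e', he', -, hadd⟩ := T.exists_iterate_add (T.X_subset hpX) 1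
    refine hq ⟨min e e', lt_min he he', fun x hx => ?_⟩
    have := hadd (x - q) ⟨by linarith [hx.1], by linarith [hx.2, min_le_right e e']⟩
    simp only [Function.iterate_one, hpq, add_sub_cancel] at this
    rw [← this]
    exact T.f_mem_X (hsub ⟨by linarith [hx.1], by linarith [hx.2, min_le_left e e']⟩)
  choose g hg using hpre
  by_contra hcon
  have hpF : p ∈ F := ⟨hp, hcon⟩
  have : Finite F := hFfin
  have hinj : Function.Injective g := fun a b hab => Subtype.ext (by rw [← hg a, ← hg b, hab])
  obtain ⟨m, hm, hper⟩ := hinj.mem_periodicPts ⟨p, hpF⟩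
  have hiter : ∀ (n : ℕ) (q : F), T.f^[n] (g^[n] q : F) = q := by
    intro n
    induction n with
    | zero => intro q; rfl
    | succ n ih => intro q; rw [Function.iterate_succ_apply, Function.iterate_succ_apply', hg, ih]
  have hfp : T.f^[m] p = p := by
    have := hiter m ⟨p, hpF⟩
    rwa [show g^[m] ⟨p, hpF⟩ = ⟨p, hpF⟩ from hper] at this
  obtain ⟨e, he, hI, hadd⟩ := T.exists_iterate_add (T.X_subset hp) m
  refine hcon ⟨e, he, fun x hx => T.mem_X_of_periodic (hI hx) hm ?_⟩
  have := hadd (x - p) ⟨by linarith [hx.1], by linarith [hx.2]⟩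
  rwa [hfp, add_sub_cancel] at this

theorem isStep_X (T : ITM r) (hfin : Finite (ConnectedComponents T.Xbar)) : IsStep T.X := by
  have hs := finite_components hfin
  have hX : T.X = ⋃ C ∈ hs.toFinset, Ico (sInf C) (sSup C) := by
    ext p
    simp only [mem_iUnion, Finite.mem_toFinset, mem_ofPred_eq, exists_prop]
    constructor
    · intro hp
      have hpK : p ∈ T.Xbar := subset_closure hp
      refine ⟨_, ⟨p, hpK, rfl⟩, ?_⟩
      have hIcc := component_eq_Icc T.isCompact_Xbar hpK
      obtain ⟨e, he, hsub⟩ := T.exists_Ico_subset_X hfin hp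
      have h1 : Ico p (p + e) ⊆ connectedComponentIn T.Xbar p :=
        isPreconnected_Ico.subset_connectedComponentIn ⟨le_rfl, by linarith⟩
          (hsub.trans subset_closure)
      rw [hIcc] at h1
      have h2 := h1 (a := p) ⟨le_rfl, by linarith⟩
      have h3 := h1 (a := p + e / 2) ⟨by linarith, by linarith⟩
      exact ⟨h2.1, by linarith [h3.2]⟩
    · rintro ⟨_, ⟨q, hq, rfl⟩, hp⟩
      have hIcc := component_eq_Icc T.isCompact_Xbar hq
      refine T.Ico_subset_X (Ico_subset_Icc_self.trans ?_) hp
      rw [← hIcc]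
      exact connectedComponentIn_subset _ _
  rw [hX]
  exact isStep_biUnion _ fun _ _ => isStep_Ico _ _

open MeasureTheory in
theorem volume_image_le (T : ITM r) {A : Set ℝ} (hA : A ⊆ unitIco) (hm : MeasurableSet A) :
    volume (T.f '' A) ≤ volume A := by
  rw [T.image_f_eq hA]
  refine (measure_biUnion_finset_le _ _).trans ?_
  have h1 : ∀ i, volume ((fun x => x + T.gamma i) '' (A ∩ T.cell i)) = volume (A ∩ T.cell i) := by
    intro i
    rw [image_add_right, measure_preimage_add_right]
  simp only [h1]
  rw [← measure_biUnion_finset]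
  · exact measure_mono (iUnion₂_subset fun i _ => inter_subset_left)
  · intro i _ j _ hij
    exact Set.disjoint_left.mpr fun x hx hx' => hij (T.cell_disjoint hx.2 hx'.2)
  · exact fun i _ => hm.inter measurableSet_Ico

open MeasureTheory in
/-- The map is injective on an attractor which is a finite union of half-open intervals. -/
theorem injOn_X (T : ITM r) (hX : IsStep T.X) : InjOn T.f T.X := by
  intro p hp p' hp' heq
  by_contra hne
  wlog hlt : p < p' generalizing p p'
  · exact this hp' hp heq.symm (Ne.symm hne) (lt_of_le_of_ne (not_lt.mp hlt) (Ne.symm hne))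
  obtain ⟨e₁, he₁, h₁⟩ := hX.right p
  obtain ⟨e₂, he₂, h₂⟩ := hX.right p'
  obtain ⟨e₃, he₃, -, h₃⟩ := T.exists_iterate_add (T.X_subset hp) 1
  obtain ⟨e₄, he₄, -, h₄⟩ := T.exists_iterate_add (T.X_subset hp') 1
  obtain ⟨e, he, hlt_e⟩ : ∃ e > 0, e < e₁ ∧ e < e₂ ∧ e < e₃ ∧ e < e₄ ∧ e < p' - p := by
    obtain ⟨e, he, hlt⟩ := exists_between
      (show (0 : ℝ) < min e₁ (min e₂ (min e₃ (min e₄ (p' - p)))) by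
        simp only [lt_min_iff]; exact ⟨he₁, he₂, he₃, he₄, by linarith⟩)
    simp only [lt_min_iff] at hlt
    exact ⟨e, he, hlt⟩
  obtain ⟨l1, l2, l3, l4, l5⟩ := hlt_e
  have hsub : T.X ⊆ T.f '' (T.X \ Ico p' (p' + e)) := by
    intro q hq
    obtain ⟨x, hx, rfl⟩ := T.exists_preimage_X hq
    by_cases hxI : x ∈ Ico p' (p' + e)
    · refine ⟨p + (x - p'), ⟨?_, fun h => by linarith [h.1, hxI.2]⟩, ?_⟩
      · exact (h₁ _ ⟨by linarith [hxI.1], by linarith [hxI.2]⟩).mpr hp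
      · have ha := h₃ (x - p') ⟨by linarith [hxI.1], by linarith [hxI.2]⟩
        have hb := h₄ (x - p') ⟨by linarith [hxI.1], by linarith [hxI.2]⟩
        simp only [Function.iterate_one, add_sub_cancel] at ha hb
        rw [ha, hb, heq]
    · exact ⟨x, ⟨hx, hxI⟩, rfl⟩
  have hIX : Ico p' (p' + e) ⊆ T.X := fun x hx => (h₂ x ⟨hx.1, by linarith [hx.2]⟩).mpr hp'
  have hle := (measure_mono hsub).trans (T.volume_image_le (sdiff_subset.trans T.X_subset)
    (hX.measurableSet.diff measurableSet_Ico))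
  have hfin : volume (T.X \ Ico p' (p' + e)) ≠ ⊤ :=
    ((measure_mono (sdiff_subset.trans T.X_subset)).trans_lt
      (by rw [unitIco]; simp)).ne
  have hsum : volume (T.X \ Ico p' (p' + e)) + volume (Ico p' (p' + e)) = volume T.X := by
    rw [← measure_sdiff_add_inter T.X (measurableSet_Ico (a := p') (b := p' + e)),
      inter_eq_self_of_subset_right hIX]
  rw [← hsum, Real.volume_Ico] at hle
  have := ENNReal.le_sub_of_add_le_left hfin hle
  rw [tsub_self] at this
  simp only [nonpos_iff_eq_zero, ENNReal.ofReal_eq_zero] at this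
  linarith

theorem IsIntervalComponent.subset_X {T : ITM r} {J : Set ℝ} (hJ : T.IsIntervalComponent J) :
    J ⊆ T.X := by
  obtain ⟨⟨z, -, rfl⟩, -⟩ := hJ
  exact connectedComponentIn_subset _ _

theorem IsIntervalComponent.absorbs {T : ITM r} {J S : Set ℝ} (hJ : T.IsIntervalComponent J)
    (hS : IsPreconnected S) (hSX : S ⊆ T.X) {w : ℝ} (hw : w ∈ S) (hwJ : w ∈ J) : S ⊆ J := by
  obtain ⟨⟨z, -, rfl⟩, -⟩ := hJ
  rw [connectedComponentIn_eq hwJ]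
  exact hS.subset_connectedComponentIn hw hSX

theorem injOn_iterate_X (T : ITM r) (hX : IsStep T.X) (n : ℕ) : InjOn T.f^[n] T.X :=
  (T.injOn_X hX).iterate (fun _ => T.f_mem_X) n

/-- Orbit segments of two points of a component, both without returns, do not collide. -/
theorem eq_of_iterate_eq (T : ITM r) (hX : IsStep T.X) {J : Set ℝ} (hJ : J ⊆ T.X) {z z' : ℝ}
    (hz : z ∈ J) (hz' : z' ∈ J) {k k' : ℕ} (heq : T.f^[k] z = T.f^[k'] z')
    (hk : ∀ j, 0 < j → j ≤ k → T.f^[j] z ∉ J) (hk' : ∀ j, 0 < j → j ≤ k' → T.f^[j] z' ∉ J) :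
    z = z' := by
  wlog hle : k ≤ k' generalizing z z' k k'
  · exact (this hz' hz heq.symm hk' hk (by omega)).symm
  rw [show k' = k + (k' - k) by omega, Function.iterate_add_apply] at heq
  have h := T.injOn_iterate_X hX k (hJ hz) (T.iterate_mem_X (hJ hz') _) heq
  rcases Nat.eq_zero_or_pos (k' - k) with h0 | h0
  · rw [h0] at h; exact h
  · exact absurd (h ▸ hz) (hk' _ h0 (by omega))

/-- Finitely many points of a component land on a discontinuity before returning. -/
theorem finite_landing (T : ITM r) (hX : IsStep T.X) {J : Set ℝ} (hJ : J ⊆ T.X) :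
    {z ∈ J | ∃ k, T.f^[k] z ∈ T.critSet ∧ ∀ j, 0 < j → j ≤ k → T.f^[j] z ∉ J}.Finite := by
  set Z := {z ∈ J | ∃ k, T.f^[k] z ∈ T.critSet ∧ ∀ j, 0 < j → j ≤ k → T.f^[j] z ∉ J}
  have h : ∀ z : ℝ, ∃ k, z ∈ Z →
      T.f^[k] z ∈ T.critSet ∧ ∀ j, 0 < j → j ≤ k → T.f^[j] z ∉ J := by
    intro z
    by_cases hz : z ∈ Z
    · exact ⟨hz.2.choose, fun _ => hz.2.choose_spec⟩
    · exact ⟨0, fun h => absurd h hz⟩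
  choose k hk using h
  refine Finite.of_injOn (f := fun z => T.f^[k z] z) (t := T.critSet) (fun z hz => (hk z hz).1)
    (fun z hz z' hz' heq => ?_) T.critSet_finite
  exact T.eq_of_iterate_eq hX hJ hz.1 hz'.1 heq (hk z hz).2 (hk z' hz').2

theorem iterate_Ico_subset_X (T : ITM r) {a e : ℝ} {n : ℕ} (hI : Ico a (a + e) ⊆ T.X)
    (h : ∀ t ∈ Ico 0 e, T.f^[n] (a + t) = T.f^[n] a + t) :
    Ico (T.f^[n] a) (T.f^[n] a + e) ⊆ T.X := by
  intro w hw
  have := h (w - T.f^[n] a) ⟨by linarith [hw.1], by linarith [hw.2]⟩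
  rw [add_sub_cancel] at this
  rw [← this]
  exact T.iterate_mem_X (hI ⟨by linarith [hw.1], by linarith [hw.2]⟩) n

theorem exists_close_iterates (T : ITM r) {a e : ℝ} (ha : a ∈ unitIco) (he : 0 < e) :
    ∃ i j : ℕ, i < j ∧ |T.f^[i] a - T.f^[j] a| < e := by
  have hmem : ∀ n : ℕ, ⌊T.f^[n] a / e⌋ ∈ Finset.Icc 0 ⌊1 / e⌋ := by
    intro n
    have := T.iterate_mem ha n
    rw [Finset.mem_Icc]
    refine ⟨Int.floor_nonneg.mpr (div_nonneg this.1 he.le), Int.floor_le_floor ?_⟩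
    exact div_le_div_of_nonneg_right this.2.le he.le
  obtain ⟨i, j, hne, heq⟩ := Finite.exists_ne_map_eq_of_infinite
    (fun n : ℕ => (⟨_, hmem n⟩ : Finset.Icc 0 ⌊1 / e⌋))
  have key : |T.f^[i] a - T.f^[j] a| < e := by
    have h := Int.abs_sub_lt_one_of_floor_eq_floor (Subtype.ext_iff.mp heq)
    rwa [← sub_div, abs_div, abs_of_pos he, div_lt_one he] at h
  rcases lt_or_gt_of_ne hne with h | h
  · exact ⟨i, j, h, key⟩
  · exact ⟨j, i, h, by rwa [abs_sub_comm]⟩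

/-- Every point of an interval component returns to it. -/
theorem exists_return (T : ITM r) (hX : IsStep T.X) {J : Set ℝ} (hJ : T.IsIntervalComponent J)
    {a : ℝ} (ha : a ∈ J) : ∃ n, 0 < n ∧ T.f^[n] a ∈ J := by
  by_contra! hno
  have hJX := hJ.subset_X
  obtain ⟨x, y, hxy, hJxy⟩ := hJ.2
  have haxy : a ∈ Ico x y := hJxy ▸ ha
  have hZ := T.finite_landing hX hJX
  set Z := {z ∈ J | ∃ k, T.f^[k] z ∈ T.critSet ∧ ∀ j, 0 < j → j ≤ k → T.f^[j] z ∉ J}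
  obtain ⟨e, he, heJ, heZ⟩ : ∃ e > 0, Ico a (a + e) ⊆ J ∧ ∀ z ∈ Ioo a (a + e), z ∉ Z := by
    have hfin : (Z ∩ Ioi a).Finite := hZ.inter_of_left _
    have hev : ∀ᶠ t in nhds a, t ∉ Z ∩ Ioi a :=
      hfin.isClosed.isOpen_compl.mem_nhds fun h => lt_irrefl a h.2
    obtain ⟨d, hd, hball⟩ := Metric.eventually_nhds_iff.mp hev
    refine ⟨min d (y - a), lt_min hd (by linarith [haxy.2]), fun w hw => ?_, fun z hz hzZ => ?_⟩
    · rw [hJxy]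
      exact ⟨haxy.1.trans hw.1, by linarith [hw.2, min_le_right d (y - a)]⟩
    · refine hball (y := z) ?_ ⟨hzZ, hz.1⟩
      rw [Real.dist_eq, abs_of_pos (by linarith [hz.1])]
      linarith [hz.2, min_le_left d (y - a)]
  have hIX : Ico a (a + e) ⊆ T.X := heJ.trans hJX
  have hmeet : ∀ n, 0 < n → (∀ t ∈ Ico 0 e, T.f^[n] (a + t) = T.f^[n] a + t) →
      ∀ t ∈ Ico 0 e, T.f^[n] (a + t) ∉ J := by
    intro n hn hadd t ht hmem
    rw [hadd t ht] at hmem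
    refine hno n hn (hJ.absorbs isPreconnected_Ico (T.iterate_Ico_subset_X hIX hadd)
      (w := T.f^[n] a + t) ⟨by linarith [ht.1], by linarith [ht.2]⟩ hmem ⟨le_rfl, by linarith⟩)
  have hnever : ∀ k, ∀ z ∈ Ioo a (a + e), T.f^[k] z ∉ T.critSet := by
    intro k
    induction k using Nat.strong_induction_on with
    | _ k ih =>
      intro z hz hcrit
      refine heZ z hz ⟨heJ ⟨hz.1.le, hz.2⟩, k, hcrit, fun j hj hjk => ?_⟩
      have := hmeet j hj (T.iterate_add (hIX.trans T.X_subset) j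
        fun w hw l hl => ih l (by omega) w hw) (z - a) ⟨by linarith [hz.1], by linarith [hz.2]⟩
      rwa [add_sub_cancel] at this
  have hadd : ∀ n, ∀ t ∈ Ico 0 e, T.f^[n] (a + t) = T.f^[n] a + t := fun n =>
    T.iterate_add (hIX.trans T.X_subset) n fun w hw l _ => hnever l w hw
  have haX : a ∈ T.X := hJX ha
  obtain ⟨i, j, hij, hclose⟩ := T.exists_close_iterates (T.X_subset haX) he
  rw [abs_lt] at hclose
  rcases le_total (T.f^[i] a) (T.f^[j] a) with h | h
  · have h1 := hadd i (T.f^[j] a - T.f^[i] a) ⟨by linarith, by linarith [hclose.1]⟩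
    rw [add_sub_cancel] at h1
    have h2 : T.f^[i] (a + (T.f^[j] a - T.f^[i] a)) = T.f^[i] (T.f^[j - i] a) := by
      rw [← Function.iterate_add_apply, show i + (j - i) = j by omega, h1]
    have hmemJ : a + (T.f^[j] a - T.f^[i] a) ∈ J := heJ ⟨by linarith, by linarith [hclose.1]⟩
    have h3 := T.injOn_iterate_X hX i (hJX hmemJ) (T.iterate_mem_X haX _) h2
    exact hno (j - i) (by omega) (h3 ▸ hmemJ)
  · have ht : T.f^[i] a - T.f^[j] a ∈ Ico 0 e := ⟨by linarith, by linarith [hclose.2]⟩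
    have h1 := hadd j _ ht
    rw [add_sub_cancel] at h1
    have hmemJ : a + (T.f^[i] a - T.f^[j] a) ∈ J := heJ ⟨by linarith [ht.1], by linarith [ht.2]⟩
    have h2 : T.f^[i] (T.f^[j - i] (a + (T.f^[i] a - T.f^[j] a))) = T.f^[i] a := by
      rw [← Function.iterate_add_apply, show i + (j - i) = j by omega, h1]
    have h3 := T.injOn_iterate_X hX i (T.iterate_mem_X (hJX hmemJ) _) haX h2
    exact hmeet (j - i) (by omega) (hadd _) _ ht (by rw [h3]; exact ha)

theorem returnTime_pos_mem (T : ITM r) (hX : IsStep T.X) {J : Set ℝ}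
    (hJ : T.IsIntervalComponent J) {a : ℝ} (ha : a ∈ J) :
    0 < T.returnTime J a ∧ T.f^[T.returnTime J a] a ∈ J :=
  Nat.sInf_mem (s := {k : ℕ | 0 < k ∧ T.f^[k] a ∈ J}) (T.exists_return hX hJ ha)

theorem notMem_of_lt_returnTime (T : ITM r) {J : Set ℝ} {a : ℝ} {j : ℕ} (hj : 0 < j)
    (hlt : j < T.returnTime J a) : T.f^[j] a ∉ J := fun h =>
  Nat.notMem_of_lt_sInf (s := {k : ℕ | 0 < k ∧ T.f^[k] a ∈ J}) hlt ⟨hj, h⟩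

/-- A component none of whose interior points lands on a discontinuity before returning is
dynamically trivial. -/
theorem dynTrivial_of_noCrit (T : ITM r) (hX : IsStep T.X) {J : Set ℝ}
    (hJ : T.IsIntervalComponent J)
    (h : ∀ a ∈ interior J, ∀ k < T.returnTime J a, T.f^[k] a ∉ T.critSet) : T.DynTrivial J := by
  have hJX := hJ.subset_X
  obtain ⟨x, y, hxy, hJxy⟩ := hJ.2
  have hint : interior J = Ioo x y := by rw [hJxy, interior_Ico]
  have hxJ : x ∈ J := by rw [hJxy]; exact ⟨le_rfl, hxy⟩
  obtain ⟨n, ⟨a₀, ha₀, rfl⟩, hmin⟩ : ∃ n ∈ T.returnTime J '' J, ∀ m ∈ T.returnTime J '' J, n ≤ m :=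
    ⟨sInf (T.returnTime J '' J), Nat.sInf_mem ⟨_, x, hxJ, rfl⟩, fun m hm => Nat.sInf_le hm⟩
  set n := T.returnTime J a₀
  have hn := T.returnTime_pos_mem hX hJ ha₀
  have hIJ : Ico x (x + (y - x)) = J := by rw [add_sub_cancel, hJxy]
  have hadd := T.iterate_add (a := x) (e := y - x) (by rw [hIJ]; exact hJX.trans T.X_subset) n
    fun z hz k hk => h z (by rw [hint]; rwa [add_sub_cancel] at hz) k
      (hk.trans_le (hmin _ ⟨z, by rw [← hIJ]; exact ⟨hz.1.le, hz.2⟩, rfl⟩))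
  have hsub : Ico (T.f^[n] x) (T.f^[n] x + (y - x)) ⊆ J := by
    have ha₀' : a₀ ∈ Ico x y := hJxy ▸ ha₀
    have heq := hadd (a₀ - x) ⟨by linarith [ha₀'.1], by linarith [ha₀'.2]⟩
    rw [add_sub_cancel] at heq
    exact hJ.absorbs isPreconnected_Ico (T.iterate_Ico_subset_X (by rw [hIJ]; exact hJX) hadd)
      (w := T.f^[n] a₀) ⟨by linarith [ha₀'.1], by linarith [ha₀'.2]⟩ hn.2
  have hfx : T.f^[n] x = x := by
    have h1 : T.f^[n] x ∈ Ico x y := hJxy ▸ hsub ⟨le_rfl, by linarith⟩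
    by_contra hne
    have h2 : x < T.f^[n] x := lt_of_le_of_ne h1.1 (Ne.symm hne)
    have h3 : y ∈ Ico x y := hJxy ▸ hsub ⟨h1.2.le, by linarith⟩
    exact lt_irrefl y h3.2
  have hid : ∀ z ∈ J, T.f^[n] z = z := by
    intro z hz
    have hz' : z ∈ Ico x y := hJxy ▸ hz
    have := hadd (z - x) ⟨by linarith [hz'.1], by linarith [hz'.2]⟩
    rwa [hfx, add_sub_cancel] at this
  have hrt : ∀ z ∈ J, T.returnTime J z = n := fun z hz =>
    le_antisymm (Nat.sInf_le ⟨hn.1, by rw [hid z hz]; exact hz⟩) (hmin _ ⟨z, hz, rfl⟩)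
  refine ⟨hJ, fun a ha ⟨k, hk⟩ => ?_, fun z hz => by rw [returnMap, hrt z hz, hid z hz]⟩
  have haJ := interior_subset ha
  refine h a ha (k % n) (by rw [hrt a haJ]; exact Nat.mod_lt _ hn.1) ?_
  rwa [Function.IsPeriodicPt.iterate_mod_apply (hid a haJ)]

/-- The jump `F(p⁻) - F(p)` of a step function. -/
noncomputable def jump (F : ℝ → ℝ) (p : ℝ) : ℝ := limUnder (nhdsWithin p (Iio p)) F - F p

theorem jump_eq {F : ℝ → ℝ} {p c : ℝ} (h : ∀ᶠ t in nhdsWithin p (Iio p), F t = c) :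
    jump F p = c - F p := by
  rw [jump, (tendsto_const_nhds.congr' (h.mono fun _ ht => ht.symm)).limUnder_eq]

theorem eventually_indicator_Ico (a b p : ℝ) : ∀ᶠ t in nhdsWithin p (Iio p),
    (Ico a b).indicator (1 : ℝ → ℝ) t = if a < p ∧ p ≤ b then 1 else 0 := by
  by_cases h : a < p ∧ p ≤ b
  · rw [if_pos h]
    filter_upwards [Ioo_mem_nhdsLT h.1] with t ht
    exact indicator_of_mem (s := Ico a b) ⟨ht.1.le, ht.2.trans_le h.2⟩ _
  · rw [if_neg h]
    rcases le_or_gt p a with hp | hp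
    · filter_upwards [self_mem_nhdsWithin] with t ht
      exact indicator_of_notMem (fun h' => absurd (lt_of_lt_of_le ht hp) (not_lt.mpr h'.1)) _
    · have hb : b < p := not_le.mp fun hb => h ⟨hp, hb⟩
      filter_upwards [Ioo_mem_nhdsLT hb] with t ht
      exact indicator_of_notMem (fun h' => absurd h'.2 (not_lt.mpr ht.1.le)) _

theorem stepSpan_left {F : ℝ → ℝ} (hF : F ∈ stepSpan) (p : ℝ) :
    ∃ c, ∀ᶠ t in nhdsWithin p (Iio p), F t = c := by
  induction hF using Submodule.span_induction with
  | mem x hx =>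
    obtain ⟨q, rfl⟩ := hx
    exact ⟨_, eventually_indicator_Ico q.1 q.2 p⟩
  | zero => exact ⟨0, Eventually.of_forall fun _ => rfl⟩
  | add x y hx hy h1 h2 =>
    obtain ⟨c, h1⟩ := h1
    obtain ⟨d, h2⟩ := h2
    exact ⟨c + d, by filter_upwards [h1, h2] with t h1 h2; rw [Pi.add_apply, h1, h2]⟩
  | smul a x hx h =>
    obtain ⟨c, h⟩ := h
    exact ⟨a • c, by filter_upwards [h] with t h; rw [Pi.smul_apply, h]⟩

theorem jump_add {F G : ℝ → ℝ} (hF : F ∈ stepSpan) (hG : G ∈ stepSpan) (p : ℝ) :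
    jump (F + G) p = jump F p + jump G p := by
  obtain ⟨c, hc⟩ := stepSpan_left hF p
  obtain ⟨d, hd⟩ := stepSpan_left hG p
  have : ∀ᶠ t in nhdsWithin p (Iio p), (F + G) t = c + d := by
    filter_upwards [hc, hd] with t h1 h2; rw [Pi.add_apply, h1, h2]
  rw [jump_eq hc, jump_eq hd, jump_eq this, Pi.add_apply]
  ring

theorem jump_smul {F : ℝ → ℝ} (hF : F ∈ stepSpan) (a p : ℝ) :
    jump (a • F) p = a * jump F p := by
  obtain ⟨c, hc⟩ := stepSpan_left hF p
  have : ∀ᶠ t in nhdsWithin p (Iio p), (a • F) t = a * c := by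
    filter_upwards [hc] with t h; rw [Pi.smul_apply, h, smul_eq_mul]
  rw [jump_eq hc, jump_eq this, Pi.smul_apply, smul_eq_mul]
  ring

theorem jump_zero (p : ℝ) : jump 0 p = 0 := by
  rw [jump_eq (F := 0) (c := 0) (Eventually.of_forall fun _ => rfl), Pi.zero_apply, sub_zero]

theorem jump_Ico {a b : ℝ} (hab : a < b) (p : ℝ) :
    jump ((Ico a b).indicator 1) p = (if p = b then 1 else 0) - (if p = a then 1 else 0) := by
  rw [jump_eq (eventually_indicator_Ico a b p), indicator_apply]
  simp only [mem_Ico, Pi.one_apply]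
  split_ifs <;> grind

theorem finite_support_jump {F : ℝ → ℝ} (hF : F ∈ stepSpan) :
    (Function.support (jump F)).Finite := by
  induction hF using Submodule.span_induction with
  | mem x hx =>
    obtain ⟨⟨a, b⟩, rfl⟩ := hx
    rcases lt_or_ge a b with hab | hab
    · refine ({a, b} : Set ℝ).toFinite.subset fun p hp => ?_
      rw [Function.mem_support] at hp
      dsimp only at hp
      rw [jump_Ico hab] at hp
      by_contra hn
      simp only [mem_insert_iff, mem_singleton_iff, not_or] at hn
      exact hp (by rw [if_neg hn.1, if_neg hn.2, sub_zero])
    · refine finite_empty.subset fun p hp => hp ?_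
      dsimp only
      rw [Ico_eq_empty (not_lt.mpr hab), indicator_empty]
      exact jump_zero p
  | zero => exact finite_empty.subset fun p hp => hp (jump_zero p)
  | add x y hx hy h1 h2 =>
    refine (h1.union h2).subset fun p hp => ?_
    by_contra hn
    simp only [mem_union, Function.mem_support, not_or, not_not] at hn
    exact hp (by rw [jump_add hx hy, hn.1, hn.2, add_zero])
  | smul a x hx h =>
    refine h.subset fun p hp hn => hp ?_
    rw [jump_smul hx, hn, mul_zero]

theorem jump_translate {F : ℝ → ℝ} (hF : F ∈ stepSpan) (c p : ℝ) :
    jump (fun x => F (x - c)) (p + c) = jump F p := by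
  obtain ⟨d, hd⟩ := stepSpan_left hF p
  have : ∀ᶠ t in nhdsWithin (p + c) (Iio (p + c)), F (t - c) = d := by
    have hmap : Tendsto (fun t => t - c) (nhdsWithin (p + c) (Iio (p + c)))
        (nhdsWithin p (Iio p)) := by
      refine tendsto_nhdsWithin_iff.mpr ⟨?_, ?_⟩
      · have : Tendsto (fun t : ℝ => t - c) (nhds (p + c)) (nhds (p + c - c)) :=
          (continuous_id.sub continuous_const).tendsto _
        rw [add_sub_cancel_right] at this
        exact this.mono_left nhdsWithin_le_nhds
      · filter_upwards [self_mem_nhdsWithin] with t ht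
        exact sub_lt_iff_lt_add.mpr (mem_Iio.mp ht)
    exact hmap.eventually hd
  rw [jump_eq hd, jump_eq this, add_sub_cancel_right]

/-- The pairing `∑ g(p) (F(p⁻) - F(p))`; on the indicator of `[a, b)` it equals `g b - g a`. -/
noncomputable def pairing (g F : ℝ → ℝ) : ℝ := ∑ᶠ p, g p * jump F p

theorem finite_support_mul_jump (g : ℝ → ℝ) {F : ℝ → ℝ} (hF : F ∈ stepSpan) :
    (Function.support fun p => g p * jump F p).Finite :=
  (finite_support_jump hF).subset fun p hp hn => hp (by
    change g p * jump F p = 0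
    rw [hn, mul_zero])

theorem pairing_add (g : ℝ → ℝ) {F G : ℝ → ℝ} (hF : F ∈ stepSpan) (hG : G ∈ stepSpan) :
    pairing g (F + G) = pairing g F + pairing g G := by
  rw [pairing, pairing, pairing, ← finsum_add_distrib (finite_support_mul_jump g hF)
    (finite_support_mul_jump g hG)]
  exact finsum_congr fun p => by rw [jump_add hF hG, mul_add]

theorem pairing_zero (g : ℝ → ℝ) : pairing g 0 = 0 := by
  rw [pairing, ← finsum_zero (α := ℝ) (M := ℝ)]
  exact finsum_congr fun p => by rw [jump_zero, mul_zero]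

theorem pairing_sum (g : ℝ → ℝ) {ι : Type*} (s : Finset ι) {F : ι → ℝ → ℝ}
    (h : ∀ i ∈ s, F i ∈ stepSpan) : pairing g (∑ i ∈ s, F i) = ∑ i ∈ s, pairing g (F i) := by
  induction s using Finset.induction_on with
  | empty => simpa using pairing_zero g
  | insert a s ha ih =>
    have hs : ∀ i ∈ s, F i ∈ stepSpan := fun i hi => h i (by simp [hi])
    rw [Finset.sum_insert ha, Finset.sum_insert ha,
      pairing_add g (h a (by simp)) (stepSpan.sum_mem hs), ih hs]

theorem pairing_left_add (g h : ℝ → ℝ) {F : ℝ → ℝ} (hF : F ∈ stepSpan) (c : ℝ) :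
    pairing (fun p => g p + c * h p) F = pairing g F + c * pairing h F := by
  rw [pairing, pairing, pairing, ← smul_eq_mul c, smul_finsum,
    ← finsum_add_distrib (finite_support_mul_jump g hF)
      ((finite_support_mul_jump h hF).subset fun p hp hn => hp (by
        change c • (h p * jump F p) = 0
        rw [show h p * jump F p = 0 from hn, smul_zero]))]
  exact finsum_congr fun p => by rw [smul_eq_mul]; ring

theorem pairing_translate (g : ℝ → ℝ) {F : ℝ → ℝ} (hF : F ∈ stepSpan) (c : ℝ) :
    pairing g (fun x => F (x - c)) = pairing (fun p => g (p + c)) F := by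
  rw [pairing, pairing, ← finsum_comp_equiv (Equiv.addRight c)]
  exact finsum_congr fun p => by rw [Equiv.coe_addRight, jump_translate hF]

theorem pairing_Ico (g : ℝ → ℝ) {a b : ℝ} (hab : a < b) :
    pairing g ((Ico a b).indicator 1) = g b - g a := by
  rw [pairing, finsum_eq_sum_of_support_subset (s := {a, b})]
  · rw [Finset.sum_pair hab.ne, jump_Ico hab, jump_Ico hab]
    simp [hab.ne, hab.ne']
    ring
  · intro p hp
    by_contra hn
    simp only [Finset.coe_insert, Finset.coe_singleton, mem_insert_iff, mem_singleton_iff,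
      not_or] at hn
    exact hp (by
      change g p * jump _ p = 0
      rw [jump_Ico hab, if_neg hn.1, if_neg hn.2, sub_zero, mul_zero])

/-- The pairing with the indicator of a disjoint union. -/
theorem pairing_union (g : ℝ → ℝ) {A B : Set ℝ} (hA : IsStep A) (hB : IsStep B)
    (hAB : Disjoint A B) : pairing g ((A ∪ B).indicator 1) =
      pairing g (A.indicator 1) + pairing g (B.indicator 1) := by
  rw [indicator_union_of_disjoint hAB, ← pairing_add g hA hB]
  rfl

theorem indicator_X_eq_sum (T : ITM r) :
    T.X.indicator (1 : ℝ → ℝ) = ∑ i, (T.X ∩ T.cell i).indicator 1 := by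
  ext x
  rw [Finset.sum_apply]
  by_cases hx : x ∈ T.X
  · obtain ⟨i, hi⟩ := T.exists_mem_cell (T.X_subset hx)
    rw [Finset.sum_eq_single i]
    · rw [indicator_of_mem hx, indicator_of_mem (show x ∈ T.X ∩ T.cell i from ⟨hx, hi⟩)]
    · exact fun j _ hj => indicator_of_notMem (fun h => hj (T.cell_disjoint h.2 hi)) _
    · simp
  · rw [indicator_of_notMem hx, Finset.sum_eq_zero]
    exact fun i _ => indicator_of_notMem (fun h => hx h.1) _

/-- The pieces of the attractor are rearranged into the attractor. -/
theorem indicator_X_inter_Ici_eq_sum (T : ITM r) (hX : IsStep T.X) (q : ℝ) :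
    (T.X ∩ Ici q).indicator (1 : ℝ → ℝ) = ∑ i, fun x =>
      (T.X ∩ T.cell i ∩ Ici (q - T.gamma i)).indicator (1 : ℝ → ℝ) (x - T.gamma i) := by
  ext x
  rw [Finset.sum_apply]
  by_cases hx : x ∈ T.X ∩ Ici q
  · obtain ⟨p, hp, rfl⟩ := T.exists_preimage_X hx.1
    obtain ⟨i, hi⟩ := T.exists_mem_cell (T.X_subset hp)
    have hfi := T.f_of_mem_cell hi
    have hq : q ≤ T.f p := hx.2
    rw [Finset.sum_eq_single i]
    · rw [indicator_of_mem hx, hfi, add_sub_cancel_right, indicator_of_mem]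
      · rfl
      · exact ⟨⟨hp, hi⟩, by rw [mem_Ici]; linarith⟩
    · refine fun j _ hj => indicator_of_notMem (fun h => hj ?_) _
      have h1 := T.f_of_mem_cell h.1.2
      rw [sub_add_cancel] at h1
      have h2 := T.injOn_X hX h.1.1 hp h1
      exact T.cell_disjoint h.1.2 (by rw [h2]; exact hi)
    · simp
  · rw [indicator_of_notMem hx, Finset.sum_eq_zero]
    refine fun i _ => indicator_of_notMem (fun h => hx ⟨?_, ?_⟩) _
    · have h1 := T.f_of_mem_cell h.1.2
      rw [sub_add_cancel] at h1
      exact h1 ▸ T.f_mem_X h.1.1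
    · have := h.2
      rw [mem_Ici] at this ⊢
      linarith

theorem isStep_X_inter_Ici (T : ITM r) (hX : IsStep T.X) (p : ℝ) : IsStep (T.X ∩ Ici p) := by
  have : T.X ∩ Ici p = T.X ∩ Ico p 1 := by
    ext x
    exact ⟨fun h => ⟨h.1, h.2, (T.X_subset h.1).2⟩, fun h => ⟨h.1, h.2.1⟩⟩
  rw [this]
  exact hX.inter (isStep_Ico _ _)

theorem isStep_X_cell_Ici (T : ITM r) (hX : IsStep T.X) (i : Fin r) (p : ℝ) :
    IsStep (T.X ∩ T.cell i ∩ Ici p) := by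
  have : T.X ∩ T.cell i ∩ Ici p = T.X ∩ Ici p ∩ T.cell i := by
    rw [inter_right_comm]
  rw [this]
  exact (T.isStep_X_inter_Ici hX p).inter (T.isStep_cell i)

/-- A functional `φ` killing all translations, with a dual family `τ` of the translations. -/
structure DualData (T : ITM r) (φ : ℝ →ₗ[ℚ] ℝ) (τ : Fin r → ℝ →ₗ[ℚ] ℝ) : Prop where
  phi_gamma : ∀ i, φ (T.gamma i) = 0
  tau_gamma : ∀ s t, τ s (T.gamma t) = if s = t then 1 else 0

theorem pairing_cell_eq_zero (T : ITM r) (hX : IsStep T.X) {φ : ℝ →ₗ[ℚ] ℝ}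
    {τ : Fin r → ℝ →ₗ[ℚ] ℝ} (hd : T.DualData φ τ) (s : Fin r) :
    pairing φ ((T.X ∩ T.cell s).indicator 1) = 0 := by
  have hstep : ∀ i, IsStep (T.X ∩ T.cell i) := fun i => hX.inter (T.isStep_cell i)
  have h1 : T.X.indicator (1 : ℝ → ℝ) = ∑ i, fun x =>
      (T.X ∩ T.cell i).indicator (1 : ℝ → ℝ) (x - T.gamma i) := by
    have h := T.indicator_X_inter_Ici_eq_sum hX (-1)
    have h0 : T.X ∩ Ici (-1) = T.X :=
      inter_eq_left.mpr fun x hx => by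
        have := (T.X_subset hx).1
        rw [mem_Ici]; linarith
    rw [h0] at h
    rw [h]
    refine Finset.sum_congr rfl fun i _ => ?_
    have hi : T.X ∩ T.cell i ∩ Ici (-1 - T.gamma i) = T.X ∩ T.cell i :=
      inter_eq_left.mpr fun x hx => by
        have h2 := T.f_of_mem_cell hx.2
        have h3 := (T.f_mem (T.X_subset hx.1)).1
        rw [mem_Ici]; linarith
    rw [hi]
  set g : ℝ → ℝ := fun p => φ p * τ s p with hg
  have h2 : pairing g (T.X.indicator 1) =
      ∑ i, pairing g ((T.X ∩ T.cell i).indicator 1) := by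
    conv_lhs => rw [T.indicator_X_eq_sum]
    exact pairing_sum g _ fun i _ => hstep i
  have h3 : pairing g (T.X.indicator 1) = ∑ i, (pairing g ((T.X ∩ T.cell i).indicator 1) +
      (if s = i then 1 else 0) * pairing φ ((T.X ∩ T.cell i).indicator 1)) := by
    conv_lhs => rw [h1]
    rw [pairing_sum g _ fun i _ => stepSpan_translate (hstep i) _]
    refine Finset.sum_congr rfl fun i _ => ?_
    rw [pairing_translate g (hstep i), ← pairing_left_add g φ (hstep i)]
    congr 1
    ext p
    rw [hg]
    dsimp only
    rw [map_add, map_add, hd.phi_gamma, hd.tau_gamma]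
    ring
  rw [h2, Finset.sum_add_distrib] at h3
  simpa using h3

theorem pairing_Ici_beta_eq_zero (T : ITM r) (hX : IsStep T.X) {φ : ℝ →ₗ[ℚ] ℝ}
    {τ : Fin r → ℝ →ₗ[ℚ] ℝ} (hd : T.DualData φ τ) (k : Fin (r + 1)) :
    pairing φ ((T.X ∩ Ici (T.beta k)).indicator 1) = 0 := by
  induction k using Fin.reverseInduction with
  | last =>
    have : T.X ∩ Ici (T.beta (Fin.last r)) = ∅ := by
      rw [T.beta_last]
      exact eq_empty_of_forall_notMem fun x hx => absurd (T.X_subset hx.1).2 (not_lt.mpr hx.2)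
    rw [this, indicator_empty]
    exact pairing_zero _
  | cast i ih =>
    have : T.X ∩ Ici (T.beta i.castSucc) = (T.X ∩ T.cell i) ∪ (T.X ∩ Ici (T.beta i.succ)) := by
      rw [← inter_union_distrib_left, cell, Ico_union_Ici_eq_Ici
        (T.beta_mono.monotone i.castSucc_lt_succ.le)]
    rw [this, pairing_union _ (hX.inter (T.isStep_cell i)) (T.isStep_X_inter_Ici hX _), ih,
      T.pairing_cell_eq_zero hX hd, add_zero]
    exact Set.disjoint_left.mpr fun x hx hx' => absurd hx.2.2 (not_lt.mpr hx'.2)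

theorem pairing_cell_Ici (T : ITM r) (hX : IsStep T.X) {φ : ℝ →ₗ[ℚ] ℝ}
    {τ : Fin r → ℝ →ₗ[ℚ] ℝ} (hd : T.DualData φ τ) (i : Fin r) (p : ℝ) :
    pairing φ ((T.X ∩ T.cell i ∩ Ici p).indicator 1) =
      if p ∈ T.cell i then pairing φ ((T.X ∩ Ici p).indicator 1) else 0 := by
  split_ifs with hp
  · have : T.X ∩ Ici p = (T.X ∩ T.cell i ∩ Ici p) ∪ (T.X ∩ Ici (T.beta i.succ)) := by
      ext x
      simp only [cell, mem_inter_iff, mem_union, mem_Ici, mem_Ico]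
      have h1 := hp.1
      have h2 := hp.2
      constructor
      · rintro ⟨hx, hpx⟩
        rcases lt_or_ge x (T.beta i.succ) with h | h
        · exact Or.inl ⟨⟨hx, h1.trans hpx, h⟩, hpx⟩
        · exact Or.inr ⟨hx, h⟩
      · rintro (⟨⟨hx, -⟩, hpx⟩ | ⟨hx, h⟩)
        · exact ⟨hx, hpx⟩
        · exact ⟨hx, h2.le.trans h⟩
    conv_rhs => rw [this]
    rw [pairing_union _ (T.isStep_X_cell_Ici hX i p) (T.isStep_X_inter_Ici hX _),
      T.pairing_Ici_beta_eq_zero hX hd, add_zero]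
    exact Set.disjoint_left.mpr fun x hx hx' => absurd hx.1.2.2 (not_lt.mpr hx'.2)
  · rcases lt_or_ge p (T.beta i.castSucc) with h | h
    · have : T.X ∩ T.cell i ∩ Ici p = T.X ∩ T.cell i :=
        inter_eq_left.mpr fun x hx => h.le.trans hx.2.1
      rw [this]
      exact T.pairing_cell_eq_zero hX hd i
    · have h' : T.beta i.succ ≤ p := not_lt.mp fun h' => hp ⟨h, h'⟩
      have : T.X ∩ T.cell i ∩ Ici p = ∅ := eq_empty_of_forall_notMem fun x hx =>
        absurd (hx.1.2.2.trans_le h') (not_lt.mpr hx.2)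
      rw [this, indicator_empty]
      exact pairing_zero _

/-- The invariant function attached to a `ℚ`-linear functional. -/
noncomputable def invariantFn (T : ITM r) (φ : ℝ →ₗ[ℚ] ℝ) (p : ℝ) : ℝ :=
  pairing φ ((T.X ∩ Ici p).indicator 1) + φ p * T.X.indicator 1 p

theorem invariantFn_eq_sum (T : ITM r) (hX : IsStep T.X) {φ : ℝ →ₗ[ℚ] ℝ}
    {τ : Fin r → ℝ →ₗ[ℚ] ℝ} (hd : T.DualData φ τ) (q : ℝ) :
    T.invariantFn φ q = ∑ i, if q - T.gamma i ∈ T.cell i then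
      T.invariantFn φ (q - T.gamma i) else 0 := by
  have h1 : pairing φ ((T.X ∩ Ici q).indicator 1) = ∑ i, if q - T.gamma i ∈ T.cell i then
      pairing φ ((T.X ∩ Ici (q - T.gamma i)).indicator 1) else 0 := by
    conv_lhs => rw [T.indicator_X_inter_Ici_eq_sum hX]
    rw [pairing_sum _ _ fun i _ => stepSpan_translate (T.isStep_X_cell_Ici hX i _) _]
    refine Finset.sum_congr rfl fun i _ => ?_
    rw [← T.pairing_cell_Ici hX hd, pairing_translate _ (T.isStep_X_cell_Ici hX i _)]
    congr 1
    ext p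
    rw [map_add, hd.phi_gamma, add_zero]
  have h2 : φ q * T.X.indicator 1 q = ∑ i, if q - T.gamma i ∈ T.cell i then
      φ (q - T.gamma i) * T.X.indicator 1 (q - T.gamma i) else 0 := by
    have h := congrFun (T.indicator_X_inter_Ici_eq_sum hX q) q
    rw [Finset.sum_apply] at h
    have hq : (T.X ∩ Ici q).indicator (1 : ℝ → ℝ) q = T.X.indicator 1 q := by
      simp [indicator_apply]
    rw [← hq, h, Finset.mul_sum]
    refine Finset.sum_congr rfl fun i _ => ?_
    rw [map_sub, hd.phi_gamma, sub_zero]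
    by_cases hc : q - T.gamma i ∈ T.cell i <;> by_cases hx : q - T.gamma i ∈ T.X <;>
      simp [hc, hx]
  rw [invariantFn, h1, h2, ← Finset.sum_add_distrib]
  refine Finset.sum_congr rfl fun i _ => ?_
  split_ifs
  · rfl
  · rw [add_zero]

theorem invariantFn_eq_zero (T : ITM r) (hX : IsStep T.X) {φ : ℝ →ₗ[ℚ] ℝ}
    {τ : Fin r → ℝ →ₗ[ℚ] ℝ} (hd : T.DualData φ τ) {p : ℝ} (hp : p ∈ unitIco) (hpX : p ∉ T.X) :
    T.invariantFn φ p = 0 := by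
  have key : ∀ n : ℕ, ∀ p ∈ unitIco, p ∉ T.Xn n → T.invariantFn φ p = 0 := by
    intro n
    induction n with
    | zero => exact fun p hp hpn => absurd (by simpa [Xn] using hp) hpn
    | succ n ih =>
      intro p _ hpn
      rw [T.invariantFn_eq_sum hX hd, Finset.sum_eq_zero]
      intro i _
      split_ifs with hi
      · refine ih _ (T.cell_subset i hi) fun hmem => hpn ?_
        rw [T.Xn_succ]
        exact ⟨_, hmem, by rw [T.f_of_mem_cell hi, sub_add_cancel]⟩
      · rfl
  rw [X, mem_iInter, not_forall] at hpX
  obtain ⟨n, hn⟩ := hpX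
  exact key n p hp hn

theorem invariantFn_f (T : ITM r) (hX : IsStep T.X) {φ : ℝ →ₗ[ℚ] ℝ}
    {τ : Fin r → ℝ →ₗ[ℚ] ℝ} (hd : T.DualData φ τ) {z : ℝ} (hz : z ∈ T.X) :
    T.invariantFn φ (T.f z) = T.invariantFn φ z := by
  obtain ⟨i, hi⟩ := T.exists_mem_cell (T.X_subset hz)
  rw [T.invariantFn_eq_sum hX hd, Finset.sum_eq_single i]
  · rw [T.f_of_mem_cell hi, add_sub_cancel_right, if_pos hi]
  · intro j _ hj
    split_ifs with hc
    · refine T.invariantFn_eq_zero hX hd (T.cell_subset j hc) fun hmem => hj ?_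
      have h1 := T.f_of_mem_cell hc
      rw [sub_add_cancel] at h1
      have h2 := T.injOn_X hX hmem hz h1
      exact T.cell_disjoint hc (by rw [h2]; exact hi)
    · rfl
  · simp

theorem invariantFn_iterate (T : ITM r) (hX : IsStep T.X) {φ : ℝ →ₗ[ℚ] ℝ}
    {τ : Fin r → ℝ →ₗ[ℚ] ℝ} (hd : T.DualData φ τ) {z : ℝ} (hz : z ∈ T.X) (n : ℕ) :
    T.invariantFn φ (T.f^[n] z) = T.invariantFn φ z := by
  induction n with
  | zero => rfl
  | succ n ih => rw [Function.iterate_succ_apply', T.invariantFn_f hX hd (T.iterate_mem_X hz n), ih]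

theorem invariantFn_beta (T : ITM r) (hX : IsStep T.X) {φ : ℝ →ₗ[ℚ] ℝ}
    {τ : Fin r → ℝ →ₗ[ℚ] ℝ} (hd : T.DualData φ τ) {k : Fin (r + 1)} (hk : T.beta k ∈ T.X) :
    T.invariantFn φ (T.beta k) = φ (T.beta k) := by
  rw [invariantFn, T.pairing_Ici_beta_eq_zero hX hd, indicator_of_mem hk, Pi.one_apply, mul_one,
    zero_add]

theorem invariantFn_eq_of_Icc_subset (T : ITM r) (hX : IsStep T.X) (φ : ℝ →ₗ[ℚ] ℝ) {p q : ℝ}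
    (hpq : p < q) (hsub : Icc p q ⊆ T.X) : T.invariantFn φ p = T.invariantFn φ q := by
  have h : T.X ∩ Ici p = Ico p q ∪ (T.X ∩ Ici q) := by
    ext x
    simp only [mem_inter_iff, mem_union, mem_Ici, mem_Ico]
    constructor
    · rintro ⟨hx, hpx⟩
      rcases lt_or_ge x q with h | h
      · exact Or.inl ⟨hpx, h⟩
      · exact Or.inr ⟨hx, h⟩
    · rintro (⟨hpx, hxq⟩ | ⟨hx, h⟩)
      · exact ⟨hsub ⟨hpx, hxq.le⟩, hpx⟩
      · exact ⟨hx, hpq.le.trans h⟩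
  have hdisj : Disjoint (Ico p q) (T.X ∩ Ici q) :=
    Set.disjoint_left.mpr fun x hx hx' => absurd hx.2 (not_lt.mpr hx'.2)
  rw [invariantFn, invariantFn, h, pairing_union _ (isStep_Ico p q) (T.isStep_X_inter_Ici hX q)
    hdisj, pairing_Ico _ hpq, indicator_of_mem (hsub ⟨le_rfl, hpq.le⟩),
    indicator_of_mem (hsub ⟨hpq.le, le_rfl⟩)]
  simp only [Pi.one_apply]
  ring

/-- Two discontinuities whose preimages are joined inside the attractor are not separated by
a functional killing all translations. -/
theorem phi_beta_eq (T : ITM r) (hX : IsStep T.X) {φ : ℝ →ₗ[ℚ] ℝ}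
    {τ : Fin r → ℝ →ₗ[ℚ] ℝ} (hd : T.DualData φ τ) {u v : ℝ} (huv : u < v)
    (hsub : Icc u v ⊆ T.X) {k l : ℕ} {a b : Fin (r + 1)} (hu : T.f^[k] u = T.beta a)
    (hv : T.f^[l] v = T.beta b) : φ (T.beta a) = φ (T.beta b) := by
  have huX : u ∈ T.X := hsub ⟨le_rfl, huv.le⟩
  have hvX : v ∈ T.X := hsub ⟨huv.le, le_rfl⟩
  rw [← T.invariantFn_beta hX hd (hu ▸ T.iterate_mem_X huX k),
    ← T.invariantFn_beta hX hd (hv ▸ T.iterate_mem_X hvX l), ← hu, ← hv,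
    T.invariantFn_iterate hX hd huX, T.invariantFn_iterate hX hd hvX]
  exact T.invariantFn_eq_of_Icc_subset hX φ huv hsub

/-- A finite union of closed intervals has finitely many connected components. -/
theorem finite_components_of_biUnion_Icc {ι : Type*} (s : Finset ι) (a b : ι → ℝ)
    (hab : ∀ i ∈ s, a i ≤ b i) {K : Set ℝ} (hK : K = ⋃ i ∈ s, Icc (a i) (b i)) :
    Finite (ConnectedComponents K) := by
  have hsub : ∀ i ∈ s, Icc (a i) (b i) ⊆ K := fun i hi => by
    rw [hK]; exact subset_biUnion_of_mem (u := fun i => Icc (a i) (b i)) hi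
  refine Finite.of_surjective (fun i : s =>
    ((⟨a i, hsub i i.2 ⟨le_rfl, hab i i.2⟩⟩ : K) : ConnectedComponents K)) ?_
  intro c
  obtain ⟨x, rfl⟩ := ConnectedComponents.surjective_coe c
  have hx : (x : ℝ) ∈ ⋃ i ∈ s, Icc (a i) (b i) := hK.subset x.2
  simp only [mem_iUnion, exists_prop] at hx
  obtain ⟨i, hi, hxi⟩ := hx
  refine ⟨⟨i, hi⟩, ?_⟩
  rw [ConnectedComponents.coe_eq_coe']
  have hpre : IsPreconnected (range (inclusion (hsub i hi))) := by
    have : PreconnectedSpace (Icc (a i) (b i)) := Subtype.preconnectedSpace isPreconnected_Icc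
    exact isPreconnected_range (continuous_inclusion _)
  exact hpre.subset_connectedComponent ⟨⟨x, hxi⟩, rfl⟩ ⟨⟨a i, le_rfl, hab i hi⟩, rfl⟩

/-- All parameters of the map are integer multiples of `1 / q`. -/
def IsGrid (T : ITM r) (q : ℕ) : Prop :=
  (∀ i, ∃ m : ℤ, T.beta i = m / q) ∧ ∀ i, ∃ m : ℤ, T.gamma i = m / q

theorem IsGrid.mem_Ico_iff {q : ℕ} (hq : 0 < q) (m n : ℤ) (z : ℝ) :
    z ∈ Ico ((m : ℝ) / q) (n / q) ↔ ⌊z * q⌋ ∈ Ico m n := by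
  have hq' : (0 : ℝ) < q := by exact_mod_cast hq
  rw [mem_Ico, mem_Ico, div_le_iff₀ hq', lt_div_iff₀ hq', Int.le_floor, Int.floor_lt]

theorem IsGrid.mem_Xn {T : ITM r} {q : ℕ} (hq : 0 < q) (h : T.IsGrid q) (n : ℕ) {z w : ℝ}
    (hz : z ∈ T.Xn n) (hzw : ⌊z * q⌋ = ⌊w * q⌋) : w ∈ T.Xn n := by
  have hq' : (q : ℝ) ≠ 0 := by exact_mod_cast hq.ne'
  induction n generalizing z w with
  | zero =>
    have h0 : T.Xn 0 = Ico ((0 : ℤ) / q : ℝ) ((q : ℤ) / q) := by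
      rw [Xn, Function.iterate_zero, image_id, unitIco]
      simp [hq']
    rw [h0] at hz ⊢
    rw [mem_Ico_iff hq] at hz ⊢
    rwa [← hzw]
  | succ n ih =>
    rw [T.Xn_succ] at hz ⊢
    obtain ⟨p, hp, rfl⟩ := hz
    obtain ⟨i, hi⟩ := T.exists_mem_cell (T.Xn_subset n hp)
    obtain ⟨m, hm⟩ := h.2 i
    obtain ⟨b, hb⟩ := h.1 i.castSucc
    obtain ⟨b', hb'⟩ := h.1 i.succ
    have hfl : ⌊p * q⌋ = ⌊(w - T.gamma i) * q⌋ := by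
      rw [T.f_of_mem_cell hi, hm, add_mul, div_mul_cancel₀ _ hq', Int.floor_add_intCast] at hzw
      rw [hm, sub_mul, div_mul_cancel₀ _ hq', Int.floor_sub_intCast, ← hzw, add_sub_cancel_right]
    have hcell : w - T.gamma i ∈ T.cell i := by
      rw [cell, hb, hb', mem_Ico_iff hq] at hi ⊢
      rwa [← hfl]
    exact ⟨_, ih hp hfl, by rw [T.f_of_mem_cell hcell, sub_add_cancel]⟩

theorem IsGrid.finite_components {T : ITM r} {q : ℕ} (hq : 0 < q) (h : T.IsGrid q) :
    Finite (ConnectedComponents T.Xbar) := by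
  have hq' : (0 : ℝ) < q := by exact_mod_cast hq
  set s : Finset ℤ := (Finset.Ico 0 (q : ℤ)).filter fun k => (k : ℝ) / q ∈ T.X
  have hfl : ∀ k : ℤ, ⌊(k : ℝ) / q * q⌋ = k := fun k => by
    rw [div_mul_cancel₀ _ hq'.ne', Int.floor_intCast]
  have hX : T.X = ⋃ k ∈ s, Ico ((k : ℝ) / q) ((k + 1 : ℤ) / q) := by
    ext x
    simp only [mem_iUnion, exists_prop, s, Finset.mem_filter, Finset.mem_Ico, mem_Ico_iff hq]
    constructor
    · intro hx
      have hx' : x ∈ Ico ((0 : ℤ) / q : ℝ) ((q : ℤ) / q) := by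
        have := T.X_subset hx
        simpa [unitIco, hq'.ne'] using this
      rw [mem_Ico_iff hq] at hx'
      refine ⟨⌊x * q⌋, ⟨hx', mem_iInter.mpr fun n => ?_⟩, le_rfl, by omega⟩
      exact h.mem_Xn hq n (mem_iInter.mp hx n) (hfl _).symm
    · rintro ⟨k, ⟨-, hk⟩, hxk⟩
      have : ⌊x * q⌋ = k := le_antisymm (by have := hxk.2; omega) hxk.1
      exact mem_iInter.mpr fun n => h.mem_Xn hq n (mem_iInter.mp hk n) (by rw [hfl, this])
  have hlt : ∀ k : ℤ, (k : ℝ) / q < ((k + 1 : ℤ) : ℝ) / q := fun k => by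
    push_cast
    gcongr
    linarith
  refine finite_components_of_biUnion_Icc s (fun k => (k : ℝ) / q) (fun k => ((k + 1 : ℤ) : ℝ) / q)
    (fun k _ => (hlt k).le) ?_
  rw [Xbar, hX, Finset.closure_biUnion]
  refine iUnion₂_congr fun k _ => ?_
  rw [closure_Ico (hlt k).ne]

theorem pdist_lt (T S : ITM r) {d e : ℝ} (hd : d < e) (h1 : ∀ i, |S.gamma i - T.gamma i| ≤ d)
    (h2 : ∀ i, |S.beta i - T.beta i| ≤ d) : pdist S T < e := by
  have h0 : 0 ≤ d := (abs_nonneg _).trans (h2 0)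
  refine lt_of_le_of_lt (sup_le ?_ ?_) hd
  · exact (dist_pi_le_iff h0).mpr fun i => by rw [Real.dist_eq]; exact h1 i
  · exact (dist_pi_le_iff h0).mpr fun i => by rw [Real.dist_eq]; exact h2 i

/-- Maps with rational parameters are dense. -/
theorem exists_isGrid (T : ITM r) {δ : ℝ} (hδ : 0 < δ) :
    ∃ (S : ITM r) (q : ℕ), 0 < q ∧ S.IsGrid q ∧ pdist S T < δ := by
  have hev : ∀ d : ℝ, 0 < d → ∀ᶠ q : ℕ in atTop, 1 < q * d := by
    intro d hd
    obtain ⟨n, hn⟩ := exists_nat_gt (1 / d)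
    filter_upwards [eventually_ge_atTop n] with q hq
    rw [div_lt_iff₀ hd] at hn
    have : (n : ℝ) ≤ q := by exact_mod_cast hq
    nlinarith
  obtain ⟨q, hq, hqδ, hgap⟩ := ((eventually_gt_atTop 0).and ((hev δ hδ).and
    (eventually_all.mpr fun i : Fin r => hev (T.beta i.succ - T.beta i.castSucc)
      (sub_pos.mpr (T.beta_mono i.castSucc_lt_succ))))).exists
  have hq' : (0 : ℝ) < q := by exact_mod_cast hq
  set b : Fin (r + 1) → ℤ := fun i => ⌊q * T.beta i⌋ with hb
  set c : Fin r → ℤ := fun i =>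
    max (-b i.castSucc) (min ⌊q * T.gamma i⌋ (q - b i.succ)) with hc
  have hb0 : ∀ i, 0 ≤ b i := fun i => Int.floor_nonneg.mpr (mul_nonneg hq'.le (T.beta_nonneg i))
  have hbq : ∀ i, b i ≤ q := fun i => by
    have h1 : q * T.beta i ≤ q := by nlinarith [T.beta_le_one i]
    have := Int.floor_le_floor h1
    simpa using this
  have hble : ∀ i, (b i : ℝ) ≤ q * T.beta i := fun i => Int.floor_le _
  have hblt : ∀ i, q * T.beta i - 1 < b i := fun i => Int.sub_one_lt_floor _
  have hclose : ∀ (m : ℤ) (x : ℝ), q * x - 1 < m → (m : ℝ) < q * x + 1 →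
      |(m : ℝ) / q - x| ≤ 1 / q := by
    intro m x h1 h2
    rw [show (m : ℝ) / q - x = (m - q * x) / q by field_simp, abs_div, abs_of_pos hq']
    gcongr
    exact abs_le.mpr ⟨by linarith, by linarith⟩
  refine ⟨⟨fun i => b i / q, fun i => c i / q, T.two_le_r, ?_, ?_, ?_, ?_⟩, q, hq,
    ⟨fun i => ⟨b i, rfl⟩, fun i => ⟨c i, rfl⟩⟩, ?_⟩
  · simp [hb, T.beta_zero]
  · simp [hb, T.beta_last, hq'.ne']
  · refine Fin.strictMono_iff_lt_succ.mpr fun i => ?_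
    have := hgap i
    gcongr
    have h1 := hble i.castSucc
    have h2 : q * T.beta i.castSucc + 1 < q * T.beta i.succ := by linarith
    have h3 : b i.castSucc + 1 ≤ b i.succ := Int.le_floor.mpr (by push_cast; linarith)
    omega
  · intro i
    have h1 : -b i.castSucc ≤ c i := le_max_left _ _
    have h2 : c i ≤ q - b i.succ := max_le (by have := hb0 i.castSucc; have := hbq i.succ; omega)
      (min_le_right _ _)
    have h1' : -(b i.castSucc : ℝ) ≤ c i := by exact_mod_cast h1
    have h2' : (c i : ℝ) ≤ q - b i.succ := by exact_mod_cast h2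
    constructor
    · rw [← neg_div]; gcongr
    · rw [← div_self hq'.ne', ← sub_div]; gcongr
  · refine pdist_lt _ _ (d := 1 / q) (by rw [div_lt_iff₀ hq']; linarith) (fun i => ?_) fun i => ?_
    · refine hclose _ _ ?_ ?_
      · have h1 : min ⌊q * T.gamma i⌋ (q - b i.succ) ≤ c i := le_max_right _ _
        have h2 := Int.sub_one_lt_floor (q * T.gamma i)
        have h3 := (T.gamma_mem i).2
        have h4 := hble i.succ
        have h5 : q * T.gamma i ≤ q - q * T.beta i.succ := by nlinarith
        rcases min_le_iff.mp h1 with h | h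
        · have h' : ((⌊q * T.gamma i⌋ : ℤ) : ℝ) ≤ c i := by exact_mod_cast h
          linarith
        · have h' : (q : ℝ) - b i.succ ≤ c i := by exact_mod_cast h
          linarith
      · have h1 : c i ≤ max (-b i.castSucc) ⌊q * T.gamma i⌋ :=
          max_le_max le_rfl (min_le_left _ _)
        have h2 := Int.floor_le (q * T.gamma i)
        have h3 := (T.gamma_mem i).1
        have h4 := hblt i.castSucc
        have h5 : -(q * T.beta i.castSucc) ≤ q * T.gamma i := by nlinarith
        rcases le_max_iff.mp h1 with h | h
        · have h' : (c i : ℝ) ≤ -b i.castSucc := by exact_mod_cast h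
          linarith
        · have h' : (c i : ℝ) ≤ (⌊q * T.gamma i⌋ : ℤ) := by exact_mod_cast h
          linarith
    · exact hclose _ _ (hblt i) (by linarith [hble i])

/-- A nonzero real can be completed to a `ℚ`-linearly independent family by choosing the further
members in prescribed open intervals. -/
theorem exists_linearIndependent_cons {w : ℝ} (hw : w ≠ 0) {n : ℕ} (l u : Fin n → ℝ)
    (h : ∀ i, l i < u i) :
    ∃ g : Fin n → ℝ, (∀ i, g i ∈ Ioo (l i) (u i)) ∧
      LinearIndependent ℚ (Fin.cons w g : Fin (n + 1) → ℝ) := by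
  induction n with
  | zero =>
    refine ⟨fun i => i.elim0, fun i => i.elim0, ?_⟩
    have : Subsingleton (Fin (0 + 1)) := inferInstanceAs (Subsingleton (Fin 1))
    exact LinearIndependent.of_subsingleton 0 hw
  | succ n ih =>
    obtain ⟨g, hg, hli⟩ := ih (fun i => l i.castSucc) (fun i => u i.castSucc) fun i => h _
    have hc : (Submodule.span ℚ (range (Fin.cons w g : Fin (n + 1) → ℝ)) : Set ℝ).Countable :=
      Set.countable_coe_iff.mp
        (inferInstanceAs (Countable (Submodule.span ℚ (range (Fin.cons w g : Fin (n + 1) → ℝ)))))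
    obtain ⟨y, hy, hyc⟩ := (hc.dense_compl ℝ).inter_open_nonempty _ isOpen_Ioo
      (nonempty_Ioo.mpr (h (Fin.last n)))
    refine ⟨Fin.snoc g y, fun i => ?_, ?_⟩
    · induction i using Fin.lastCases with
      | last => simpa using hy
      | cast i => simpa using hg i
    · rw [Fin.cons_snoc_eq_snoc_cons]
      exact linearIndependent_finSnoc.mpr ⟨hli, hyc⟩

theorem exists_functional {ι : Type*} {v : ι → ℝ} (hv : LinearIndependent ℚ v) (c : ι → ℝ) :
    ∃ φ : ℝ →ₗ[ℚ] ℝ, ∀ i, φ (v i) = c i := by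
  obtain ⟨φ, hφ⟩ := LinearMap.exists_extend ((Module.Basis.span hv).constr ℚ c)
  refine ⟨φ, fun i => ?_⟩
  have h1 := (Module.Basis.span hv).constr_basis ℚ c i
  rw [← hφ] at h1
  rw [← h1, LinearMap.comp_apply, Submodule.subtype_apply, Module.Basis.span_apply]

/-- Perturbing only the translation parameters, one can make them rationally independent, also
jointly with a given nonzero number. -/
theorem exists_dualData_near (T : ITM r) {w δ : ℝ} (hw : w ≠ 0) (hδ : 0 < δ) :
    ∃ (S : ITM r) (φ : ℝ →ₗ[ℚ] ℝ) (τ : Fin r → ℝ →ₗ[ℚ] ℝ), S.beta = T.beta ∧ pdist S T < δ ∧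
      S.DualData φ τ ∧ φ w = 1 := by
  have hlt : ∀ i : Fin r, -T.beta i.castSucc < 1 - T.beta i.succ := by
    intro i
    have h2 := T.two_le_r
    by_contra! hge
    have h0 := T.beta_nonneg i.castSucc
    have h1 := T.beta_le_one i.succ
    have e0 : T.beta i.castSucc = T.beta 0 := by rw [T.beta_zero]; linarith
    have e1 : T.beta i.succ = T.beta (Fin.last r) := by rw [T.beta_last]; linarith
    have e0' := congrArg Fin.val (T.beta_mono.injective e0)
    have e1' := congrArg Fin.val (T.beta_mono.injective e1)
    simp only [Fin.val_castSucc, Fin.val_zero, Fin.val_succ, Fin.val_last] at e0' e1'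
    omega
  obtain ⟨g, hg, hli⟩ := exists_linearIndependent_cons hw
    (fun i => max (-T.beta i.castSucc) (T.gamma i - δ / 2))
    (fun i => min (1 - T.beta i.succ) (T.gamma i + δ / 2)) fun i => by
      have := T.gamma_mem i
      exact max_lt (lt_min (hlt i) (by linarith [this.1])) (lt_min (by linarith [this.2])
        (by linarith))
  have hg1 : ∀ i, -T.beta i.castSucc < g i ∧ T.gamma i - δ / 2 < g i := fun i =>
    max_lt_iff.mp (hg i).1
  have hg2 : ∀ i, g i < 1 - T.beta i.succ ∧ g i < T.gamma i + δ / 2 := fun i =>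
    lt_min_iff.mp (hg i).2
  obtain ⟨φ, hφ⟩ := exists_functional hli (Fin.cons 1 0)
  choose τ hτ using fun s : Fin r =>
    exists_functional hli (Fin.cons 0 fun t => if s = t then 1 else 0)
  refine ⟨{ T with gamma := g, gamma_mem := fun i => ⟨(hg1 i).1.le, (hg2 i).1.le⟩ }, φ, τ, rfl,
    pdist_lt _ _ (half_lt_self hδ) (fun i => ?_) (fun i => ?_), ⟨fun i => ?_, fun s t => ?_⟩, ?_⟩
  · exact abs_le.mpr ⟨by linarith [(hg1 i).2], by linarith [(hg2 i).2]⟩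
  · simp only [sub_self, abs_zero]; positivity
  · simpa using hφ i.succ
  · simpa using hτ s t.succ
  · simpa using hφ 0

theorem abs_gamma_sub_le_pdist (T S : ITM r) (i : Fin r) : |S.gamma i - T.gamma i| ≤ pdist S T := by
  have := dist_le_pi_dist S.gamma T.gamma i
  rw [Real.dist_eq] at this
  exact this.trans le_sup_left

/-- An orbit segment that stays in the interiors of the cells persists under perturbation of the
translation parameters, together with its endpoint. -/
theorem exists_iterate_eq_near (T : ITM r) (k : ℕ) {u : ℝ}
    (h : ∀ j < k, ∃ i : Fin r, T.f^[j] u ∈ Ioo (T.beta i.castSucc) (T.beta i.succ)) {ε : ℝ}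
    (hε : 0 < ε) :
    ∃ η > 0, ∀ S : ITM r, S.beta = T.beta → pdist S T < η → ∀ w, |w - T.f^[k] u| < η →
      ∃ v, |v - u| < ε ∧ S.f^[k] v = w := by
  induction k generalizing ε with
  | zero => exact ⟨ε, hε, fun S _ _ w hw => ⟨w, hw, rfl⟩⟩
  | succ k ih =>
    obtain ⟨η, hη, ih⟩ := ih (fun j hj => h j (by omega)) hε
    obtain ⟨i, hi⟩ := h k (by omega)
    set z := T.f^[k] u
    set d := min η (min (z - T.beta i.castSucc) (T.beta i.succ - z)) with hd
    have hd0 : 0 < d := lt_min hη (lt_min (by linarith [hi.1]) (by linarith [hi.2]))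
    have hd1 : d ≤ η := min_le_left _ _
    have hd2 : d ≤ z - T.beta i.castSucc := (min_le_right _ _).trans (min_le_left _ _)
    have hd3 : d ≤ T.beta i.succ - z := (min_le_right _ _).trans (min_le_right _ _)
    refine ⟨d / 2, by positivity, fun S hS hST w hw => ?_⟩
    rw [Function.iterate_succ_apply', T.f_of_mem_cell (i := i) ⟨hi.1.le, hi.2⟩] at hw
    have hγ := abs_le.mp ((abs_gamma_sub_le_pdist T S i).trans hST.le)
    have hw' := abs_lt.mp hw
    obtain ⟨v, hv, hvw⟩ := ih S hS (by linarith) (w - S.gamma i)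
      (abs_lt.mpr ⟨by linarith, by linarith⟩)
    refine ⟨v, hv, ?_⟩
    rw [Function.iterate_succ_apply', hvw, S.f_of_mem_cell (i := i)]
    · ring
    · rw [cell, hS]
      exact ⟨by linarith, by linarith⟩

/-- Before hitting a discontinuity, the orbit of an interior point stays in the interiors of the
cells. -/
theorem exists_mem_Ioo_of_notMem_critSet (T : ITM r) {u : ℝ} (hu : u ∈ Ioo (0 : ℝ) 1) {k : ℕ}
    (h : ∀ j < k, T.f^[j] u ∉ T.critSet) :
    ∀ j < k, ∃ i : Fin r, T.f^[j] u ∈ Ioo (T.beta i.castSucc) (T.beta i.succ) := by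
  have step : ∀ z ∈ Ioo (0 : ℝ) 1, z ∉ T.critSet →
      ∃ i : Fin r, z ∈ Ioo (T.beta i.castSucc) (T.beta i.succ) := by
    intro z hz hcrit
    obtain ⟨i, hi⟩ := T.exists_mem_cell (x := z) ⟨hz.1.le, hz.2⟩
    refine ⟨i, lt_of_le_of_ne hi.1 fun heq => ?_, hi.2⟩
    refine hcrit ⟨i.castSucc, fun h0 => ?_, (Fin.castSucc_lt_last i).ne, heq.symm⟩
    rw [h0, T.beta_zero] at heq
    exact hz.1.ne heq
  have hmem : ∀ j ≤ k, T.f^[j] u ∈ Ioo (0 : ℝ) 1 := by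
    intro j
    induction j with
    | zero => exact fun _ => hu
    | succ j ih =>
      intro hj
      obtain ⟨i, hi⟩ := step _ (ih (by omega)) (h j (by omega))
      rw [Function.iterate_succ_apply', T.f_of_mem_cell (i := i) ⟨hi.1.le, hi.2⟩]
      have := T.gamma_mem i
      exact ⟨by linarith [hi.1, this.1], by linarith [hi.2, this.2]⟩
  exact fun j hj => step _ (hmem j hj.le) (h j hj)

theorem finite_components_of_homeomorph {A B : Type*} [TopologicalSpace A] [TopologicalSpace B]
    (h : A ≃ₜ B) [Finite (ConnectedComponents A)] : Finite (ConnectedComponents B) :=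
  Finite.of_surjective _ (h.continuous.connectedComponentsMap_surjective h.surjective)

/-- Compact subsets of the line with finitely many components: points in distinct components are
uniformly far apart. -/
theorem exists_dist_components {K : Set ℝ} (hK : IsCompact K)
    [Finite (ConnectedComponents K)] :
    ∃ d > 0, ∀ x y : K, dist x y < d → (x : ConnectedComponents K) = y := by
  have : CompactSpace K := isCompact_iff_compactSpace.mp hK
  obtain ⟨d, hd, h⟩ := lebesgue_number_lemma_of_metric (s := (univ : Set K))
    (c := fun c : ConnectedComponents K => ConnectedComponents.mk ⁻¹' {c}) isCompact_univ
    (fun c => (isOpen_discrete {c}).preimage ConnectedComponents.continuous_coe)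
    (fun x _ => mem_iUnion.mpr ⟨_, rfl⟩)
  refine ⟨d, hd, fun x y hxy => ?_⟩
  obtain ⟨c, hc⟩ := h x (mem_univ x)
  have hx : ConnectedComponents.mk x = c := hc (Metric.mem_ball_self hd)
  have hy : ConnectedComponents.mk y = c := hc (Metric.mem_ball'.mpr hxy)
  exact hx.trans hy.symm

theorem Icc_subset_of_component_eq {K : Set ℝ} {x y : K}
    (h : (x : ConnectedComponents K) = y) : Icc (x : ℝ) y ⊆ K := by
  have hpre := (isPreconnected_connectedComponent (x := y)).image _
    continuous_subtype_val.continuousOn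
  exact (hpre.Icc_subset ⟨x, ConnectedComponents.coe_eq_coe'.mp h, rfl⟩
    ⟨y, mem_connectedComponent, rfl⟩).trans (by rintro _ ⟨z, -, rfl⟩; exact z.2)

/-- Intervals in a compact set with finitely many components persist in homeomorphic compact sets
that are close in the Hausdorff distance. -/
theorem exists_Icc_near {K : Set ℝ} (hK : IsCompact K) (hfin : Finite (ConnectedComponents K))
    {p q : ℝ} (hpq : p ≤ q) (hsub : Icc p q ⊆ K) {ε : ℝ} (hε : 0 < ε) :
    ∃ η > 0, ∀ L : Set ℝ, IsCompact L → Nonempty (L ≃ₜ K) → Metric.hausdorffDist L K < η →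
      ∃ s t, |s - p| < ε ∧ |t - q| < ε ∧ Icc s t ⊆ L := by
  obtain ⟨d, hd, hsep⟩ := exists_dist_components hK
  refine ⟨min (d / 3) ε, by positivity, fun L hL ⟨e⟩ hdist => ?_⟩
  set η := min (d / 3) ε
  have hη : η ≤ d / 3 := min_le_left _ _
  have hηε : η ≤ ε := min_le_right _ _
  have hpK : p ∈ K := hsub (left_mem_Icc.mpr hpq)
  have hqK : q ∈ K := hsub (right_mem_Icc.mpr hpq)
  have htop : Metric.hausdorffEDist L K ≠ ⊤ :=
    Metric.hausdorffEDist_ne_top_of_nonempty_of_bounded ⟨_, (e.symm ⟨p, hpK⟩).2⟩ ⟨p, hpK⟩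
      hL.isBounded hK.isBounded
  have hnear : ∀ x : L, ∃ y : K, dist (x : ℝ) y < η := fun x => by
    obtain ⟨y, hy, h⟩ := Metric.exists_dist_lt_of_hausdorffDist_lt x.2 hdist htop
    exact ⟨⟨y, hy⟩, h⟩
  choose g hg using hnear
  have hcomp : ∀ (x : L) (y : K), dist (x : ℝ) y < η → ConnectedComponents.mk (g x) = .mk y := by
    intro x y hxy
    refine hsep _ _ ?_
    have h1 := hg x
    rw [dist_comm] at h1
    calc dist (g x) y ≤ dist ((g x : K) : ℝ) x + dist (x : ℝ) y := dist_triangle (g x : ℝ) x y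
      _ < d := by linarith
  have hcont : Continuous fun x : L => ConnectedComponents.mk (g x) := by
    refine (IsLocallyConstant.iff_eventually_eq _ |>.mpr fun x => ?_).continuous
    filter_upwards [Metric.ball_mem_nhds x (show 0 < d / 3 by positivity)] with y hy
    refine hsep _ _ ?_
    have h1 := hg y
    rw [dist_comm] at h1
    have h2 : dist (y : ℝ) x < d / 3 := hy
    calc dist (g y) (g x) ≤ dist ((g y : K) : ℝ) y + dist (y : ℝ) x + dist (x : ℝ) (g x) :=
          dist_triangle4 (g y : ℝ) y x (g x)
      _ < d := by linarith [hg x]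
  have hnear' : ∀ y ∈ K, ∃ x : L, dist (x : ℝ) y < η := fun y hy => by
    obtain ⟨x, hx, h⟩ := Metric.exists_dist_lt_of_hausdorffDist_lt' hy hdist htop
    exact ⟨⟨x, hx⟩, h⟩
  have hsurj : Function.Surjective hcont.connectedComponentsLift := by
    intro c
    obtain ⟨y, rfl⟩ := ConnectedComponents.surjective_coe c
    obtain ⟨x, hx⟩ := hnear' y y.2
    exact ⟨ConnectedComponents.mk x,
      (hcont.connectedComponentsLift_apply_coe x).trans (hcomp x y hx)⟩
  have hinj : Function.Injective hcont.connectedComponentsLift := by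
    have hG := e.symm.continuous.connectedComponentsMap_surjective e.symm.surjective
    exact Function.Injective.of_comp_right
      (Finite.injective_iff_surjective.mpr (hsurj.comp hG)) hG
  obtain ⟨s, hs⟩ := hnear' p hpK
  obtain ⟨t, ht⟩ := hnear' q hqK
  refine ⟨s, t, hs.trans_le hηε, ht.trans_le hηε, Icc_subset_of_component_eq (hinj ?_)⟩
  rw [hcont.connectedComponentsLift_apply_coe, hcont.connectedComponentsLift_apply_coe]
  have hpq' : ConnectedComponents.mk (⟨p, hpK⟩ : K) = .mk ⟨q, hqK⟩ := by
    rw [ConnectedComponents.coe_eq_coe']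
    have hpre : IsPreconnected (range (inclusion hsub)) := by
      have : PreconnectedSpace (Icc p q) := Subtype.preconnectedSpace isPreconnected_Icc
      exact isPreconnected_range (continuous_inclusion _)
    exact hpre.subset_connectedComponent ⟨⟨q, right_mem_Icc.mpr hpq⟩, rfl⟩
      ⟨⟨p, left_mem_Icc.mpr hpq⟩, rfl⟩
  exact (hcomp s ⟨p, hpK⟩ hs).trans (hpq'.trans (hcomp t ⟨q, hqK⟩ ht).symm)

/-- The closed attractor of a stable map has finitely many connected components. -/
theorem Stable.finite_components {T : ITM r} (h : T.Stable) :
    Finite (ConnectedComponents T.Xbar) := by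
  obtain ⟨δ, hδ, hhom, -⟩ := h
  obtain ⟨S, q, hq, hS, hST⟩ := T.exists_isGrid hδ
  have := hS.finite_components hq
  exact finite_components_of_homeomorph (hhom S hST).some

/-- A point of an interval component that hits a discontinuity before returning does so for the
first time at an index before which the orbit avoids both. -/
theorem exists_first_landing (T : ITM r) {J : Set ℝ} {u : ℝ}
    (h : ∃ k < T.returnTime J u, T.f^[k] u ∈ T.critSet) :
    ∃ k a, T.f^[k] u = T.beta a ∧ (∀ j < k, T.f^[j] u ∉ T.critSet) ∧
      ∀ j, 0 < j → j ≤ k → T.f^[j] u ∉ J := by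
  obtain ⟨hlt, a, -, -, ha⟩ := Nat.find_spec h
  refine ⟨Nat.find h, a, ha, fun j hj hcrit => ?_, fun j hj hjk => ?_⟩
  · exact Nat.find_min h hj ⟨hj.trans hlt, hcrit⟩
  · exact T.notMem_of_lt_returnTime hj (hjk.trans_lt hlt)

/-- In a stable map, two distinct points in the interior of an interval component cannot both hit
discontinuities before returning. -/
theorem Stable.eq_of_landing {T : ITM r} (hT : T.Stable) {J : Set ℝ}
    (hJ : T.IsIntervalComponent J) {u v : ℝ} (hu : u ∈ interior J) (hv : v ∈ interior J)
    (hcu : ∃ k < T.returnTime J u, T.f^[k] u ∈ T.critSet)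
    (hcv : ∃ k < T.returnTime J v, T.f^[k] v ∈ T.critSet) : u = v := by
  by_contra hne
  wlog huv : u < v generalizing u v
  · exact this hv hu hcv hcu (Ne.symm hne) (lt_of_le_of_ne (not_lt.mp huv) (Ne.symm hne))
  have hfin := hT.finite_components
  have hX := T.isStep_X hfin
  have hJX := hJ.subset_X
  obtain ⟨k, a, hka, hk, hkJ⟩ := T.exists_first_landing hcu
  obtain ⟨l, b, hlb, hl, hlJ⟩ := T.exists_first_landing hcv
  have hab : T.beta a - T.beta b ≠ 0 := fun h => hne <|
    T.eq_of_iterate_eq hX hJX (interior_subset hu) (interior_subset hv)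
      (by rw [hka, hlb]; linarith) hkJ hlJ
  obtain ⟨x, y, hxy, rfl⟩ := hJ.2
  rw [interior_Ico] at hu hv
  have hunit : ∀ z ∈ Ioo x y, z ∈ Ioo (0 : ℝ) 1 := fun z hz =>
    ⟨(T.X_subset (hJX ⟨le_rfl, hxy⟩)).1.trans_lt hz.1, (T.X_subset (hJX ⟨hz.1.le, hz.2⟩)).2⟩
  obtain ⟨ε, hε, h1, h2, h3⟩ : ∃ ε > 0, 4 * ε < u - x ∧ 4 * ε < y - v ∧ 4 * ε < v - u := by
    refine ⟨min (u - x) (min (y - v) (v - u)) / 5, ?_, ?_, ?_, ?_⟩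
    · have := lt_min (sub_pos.mpr hu.1) (lt_min (sub_pos.mpr hv.2) (sub_pos.mpr huv))
      positivity
    all_goals
      have e1 := min_le_left (u - x) (min (y - v) (v - u))
      have e2 := min_le_right (u - x) (min (y - v) (v - u))
      have e3 := min_le_left (y - v) (v - u)
      have e4 := min_le_right (y - v) (v - u)
      have := lt_min (sub_pos.mpr hu.1) (lt_min (sub_pos.mpr hv.2) (sub_pos.mpr huv))
      linarith
  have hIcc : Icc (u - 2 * ε) (v + 2 * ε) ⊆ T.Xbar := fun z hz =>
    subset_closure (hJX ⟨by linarith [hz.1], by linarith [hz.2]⟩)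
  obtain ⟨η₁, hη₁, hcomp⟩ := exists_Icc_near T.isCompact_Xbar hfin (by linarith) hIcc hε
  obtain ⟨η₂, hη₂, hlandu⟩ := T.exists_iterate_eq_near k
    (T.exists_mem_Ioo_of_notMem_critSet (hunit u hu) hk) hε
  obtain ⟨η₃, hη₃, hlandv⟩ := T.exists_iterate_eq_near l
    (T.exists_mem_Ioo_of_notMem_critSet (hunit v hv) hl) hε
  obtain ⟨δ, hδ, hhom, hhaus, -⟩ := hT
  have hTT : pdist T T = 0 := by simp [pdist]
  obtain ⟨η₄, hη₄, hhaus⟩ := hhaus T (by rwa [hTT]) η₁ hη₁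
  obtain ⟨S, φ, τ, hβ, hST, hdual, hφ⟩ := T.exists_dualData_near hab
    (lt_min hδ (lt_min hη₂ (lt_min hη₃ hη₄)))
  simp only [lt_min_iff] at hST
  obtain ⟨hST1, hST2, hST3, hST4⟩ := hST
  obtain ⟨e⟩ := hhom S hST1
  have hSX : IsStep S.X := S.isStep_X (finite_components_of_homeomorph e.symm)
  obtain ⟨s, t, hs, ht, hst⟩ := hcomp S.Xbar S.isCompact_Xbar ⟨e⟩ (hhaus S hST1 hST4)
  obtain ⟨u', hu', hku'⟩ := hlandu S hβ hST2 (T.beta a) (by rwa [hka, sub_self, abs_zero])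
  obtain ⟨v', hv', hlv'⟩ := hlandv S hβ hST3 (T.beta b) (by rwa [hlb, sub_self, abs_zero])
  rw [abs_lt] at hs ht hu' hv'
  have hsub : Icc u' v' ⊆ S.X := fun z hz =>
    S.Ico_subset_X (Ico_subset_Icc_self.trans hst) ⟨by linarith [hz.1], by linarith [hz.2]⟩
  have h := S.phi_beta_eq hSX hdual (by linarith) hsub (hku'.trans (by rw [hβ]))
    (hlv'.trans (by rw [hβ]))
  rw [hβ] at h
  rw [map_sub, h, sub_self] at hφ
  exact zero_ne_one hφ

end ITM

/-- If `T ∈ ITM(r)` is stable and satisfies conditions A1 and A2, then `T` satisfies the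
Matching condition. -/
theorem matching_of_stable_A1_A2 {r : ℕ} (T : ITM r)
    (hstab : T.Stable) (h1 : T.A1) (h2 : T.A2) : T.Matching := by
  intro J hJ hnt
  have hX := T.isStep_X hstab.finite_components
  obtain ⟨a, ha, hk⟩ : ∃ a ∈ interior J, ∃ k < T.returnTime J a, T.f^[k] a ∈ T.critSet := by
    by_contra! h
    exact hnt (T.dynTrivial_of_noCrit hX hJ h)
  exact ⟨a, ⟨ha, hk⟩, fun b hb => hstab.eq_of_landing hJ hb.1 ha hb.2 hk⟩
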